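/- Let Γ be a non-elementary hyperbolic group and S, S⋆ two finite symmetric generating sets. Then the liminf defining the mean distortion is a limit: τ(S⋆/S) = lim_{n→∞} (1/n)·(1/|𝐒_n|)·Σ_{x∈𝐒_n}|x|_{S⋆}; moreover a weak law of large numbers holds: for every ε > 0, the proportion of x ∈ 𝐒_n with | |x|_{S⋆} − n·τ(S⋆/S) | > εn tends to 0 as n → ∞. -/

import Mathlib

open MeasureTheory Filter Topology
open scoped ENNReal NNReal

noncomputable section

namespace HypFlow

/-! ## Word metrics, hyperbolic metrics on groups, growth rates -/

variable {Γ : Type*}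

/-- Word length of a group element with respect to a generating set `S`. -/
def wordLength [Group Γ] (S : Set Γ) (x : Γ) : ℕ :=
  sInf {n : ℕ | ∃ l : List Γ, (∀ a ∈ l, a ∈ S) ∧ l.length = n ∧ l.prod = x}

/-- Word metric associated with a generating set `S`. -/
def wordDist [Group Γ] (S : Set Γ) (x y : Γ) : ℝ :=
  (wordLength S (x⁻¹ * y) : ℝ)

/-- `S` is a finite symmetric generating set. -/
def IsSymmGen [Group Γ] (S : Set Γ) : Prop :=
  S.Finite ∧ (∀ s ∈ S, s⁻¹ ∈ S) ∧ Subgroup.closure S = ⊤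

/-- Gromov product of `x, y` based at `w` for the metric `d`. -/
def gromov (d : Γ → Γ → ℝ) (w x y : Γ) : ℝ := (d w x + d w y - d x y) / 2

/-- `d` is a (genuine) metric on `Γ`. -/
structure IsMetric (d : Γ → Γ → ℝ) : Prop where
  refl : ∀ x, d x x = 0
  pos : ∀ x y, x ≠ y → 0 < d x y
  symm : ∀ x y, d x y = d y x
  triangle : ∀ x y z, d x z ≤ d x y + d y z

/-- `d` is `δ`-hyperbolic for some `δ ≥ 0` (Gromov product form). -/
def IsHyperbolicMetric (d : Γ → Γ → ℝ) : Prop :=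
  ∃ δ : ℝ, 0 ≤ δ ∧ ∀ w x y z : Γ, min (gromov d w x z) (gromov d w z y) - δ ≤ gromov d w x y

/-- Two metrics are quasi-isometric. -/
def QuasiIsometric (d₁ d₂ : Γ → Γ → ℝ) : Prop :=
  ∃ L C : ℝ, 0 < L ∧ 0 ≤ C ∧ ∀ x y : Γ,
    d₁ x y / L - C ≤ d₂ x y ∧ d₂ x y ≤ L * d₁ x y + C

/-- `d` belongs to `𝒟_Γ`: a left-invariant hyperbolic metric quasi-isometric to a
word metric. -/
structure InD [Group Γ] (d : Γ → Γ → ℝ) : Prop where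
  metric : IsMetric d
  leftInv : ∀ g x y : Γ, d (g * x) (g * y) = d x y
  hyp : IsHyperbolicMetric d
  qi : ∃ S : Set Γ, IsSymmGen S ∧ QuasiIsometric (wordDist S) d

/-- Strong hyperbolicity (Nica–Špakula / Mineyev). -/
def IsStronglyHyperbolic (d : Γ → Γ → ℝ) : Prop :=
  ∃ L s R₀ : ℝ, 0 ≤ L ∧ 0 < s ∧ 0 ≤ R₀ ∧
    ∀ (x x' y y' : Γ) (R : ℝ), R₀ ≤ R →
      R ≤ d x y - d x x' - d y y' + d x' y' →
      |d x y - d x' y - d x y' + d x' y'| ≤ L * Real.exp (-s * R)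

/-- Exponential volume growth rate `gr(d)` of `(Γ, d)` based at the identity. -/
def growthRate [Group Γ] (d : Γ → Γ → ℝ) : ℝ :=
  limsup (fun n : ℕ => Real.log (Nat.card {x : Γ // d 1 x ≤ (n : ℝ)}) / (n : ℝ)) atTop

/-- `Γ` is virtually cyclic. -/
def VirtuallyCyclic (Γ : Type*) [Group Γ] : Prop :=
  ∃ H : Subgroup Γ, H.FiniteIndex ∧ ∃ g : Γ, H = Subgroup.zpowers g

/-- `Γ` is a non-elementary hyperbolic group: some (equivalently, any) word metric is
hyperbolic and `Γ` is not virtually cyclic. -/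
def NonElemHyperbolic (Γ : Type*) [Group Γ] : Prop :=
  (∃ S : Set Γ, IsSymmGen S ∧ IsHyperbolicMetric (wordDist S)) ∧ ¬ VirtuallyCyclic Γ

/-! ## Mean distortion -/

/-- Cardinality of the word sphere `𝐒_n`. -/
def sphCard [Group Γ] (S : Set Γ) (n : ℕ) : ℕ :=
  Nat.card {x : Γ // wordLength S x = n}

/-- Average `S⋆`-word length over the `S`-sphere of radius `n`. -/
def meanLen [Group Γ] (S Sst : Set Γ) (n : ℕ) : ℝ :=
  (∑' x : {x : Γ // wordLength S x = n}, (wordLength Sst (x : Γ) : ℝ)) / (sphCard S n : ℝ)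

/-- Mean distortion `τ(S⋆/S)`. -/
def meanDistortion [Group Γ] (S Sst : Set Γ) : ℝ :=
  liminf (fun n : ℕ => meanLen S Sst n / (n : ℝ)) atTop

/-! ## Hausdorff measures and dimension with respect to a gauge -/

/-- Diameter of a set with respect to a gauge `ρ`. -/
def gdiam {X : Type*} (ρ : X → X → ℝ) (E : Set X) : ℝ≥0∞ :=
  ⨆ x ∈ E, ⨆ y ∈ E, ENNReal.ofReal (ρ x y)

/-- Pre-Hausdorff content at scale `Δ`. -/
def hMeasAux {X : Type*} (ρ : X → X → ℝ) (D : ℝ) (Δ : ℝ≥0∞) (E : Set X) : ℝ≥0∞ :=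
  ⨅ (c : ℕ → Set X) (_ : E ⊆ ⋃ n, c n) (_ : ∀ n, gdiam ρ (c n) ≤ Δ),
    ∑' n, gdiam ρ (c n) ^ D

/-- `D`-dimensional Hausdorff measure of a set relative to the gauge `ρ`. -/
def hMeas {X : Type*} (ρ : X → X → ℝ) (D : ℝ) (E : Set X) : ℝ≥0∞ :=
  ⨆ (Δ : ℝ≥0∞) (_ : 0 < Δ), hMeasAux ρ D Δ E

/-- Hausdorff dimension of a set relative to the gauge `ρ`. -/
def hDim {X : Type*} (ρ : X → X → ℝ) (E : Set X) : ℝ :=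
  sSup {D : ℝ | 0 ≤ D ∧ hMeas ρ D E ≠ 0}

/-- Lower Hausdorff dimension of a measure. -/
def lowerHDim {X : Type*} [MeasurableSpace X] (ρ : X → X → ℝ) (ν : Measure X) : ℝ :=
  sInf {r : ℝ | ∃ E : Set X, MeasurableSet E ∧ 0 < ν E ∧ hDim ρ E = r}

/-- Upper Hausdorff dimension of a measure. -/
def upperHDim {X : Type*} [MeasurableSpace X] (ρ : X → X → ℝ) (ν : Measure X) : ℝ :=
  sInf {r : ℝ | ∃ E : Set X, MeasurableSet E ∧ ν Eᶜ = 0 ∧ hDim ρ E = r}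

/-- Radon measure: finite on compacts and outer regular. -/
def IsRadon {X : Type*} [TopologicalSpace X] [MeasurableSpace X] (ν : Measure X) : Prop :=
  (∀ K : Set X, IsCompact K → ν K < ⊤) ∧
  (∀ A : Set X, MeasurableSet A → ν A = ⨅ (U : Set X) (_ : IsOpen U) (_ : A ⊆ U), ν U)

/-! ## Abstract boundary data for a hyperbolic metric on `Γ` -/

/-- The Gromov boundary of `(Γ, d)` packaged abstractly: a compact space `B` with a
continuous `Γ`-action, the extension of the Gromov product (based at the identity `o`)
to pairs of boundary points (`gpb`) and to a group element and a boundary point (`gpx`),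
satisfying hyperbolicity, the characteristic identities of Busemann functions and the
expected continuity properties. -/
structure BoundaryData (Γ : Type*) [Group Γ] (d : Γ → Γ → ℝ)
    (B : Type*) [TopologicalSpace B] where
  act : Γ → B → B
  act_one : ∀ ξ : B, act 1 ξ = ξ
  act_mul : ∀ (x y : Γ) (ξ : B), act (x * y) ξ = act x (act y ξ)
  act_cont : ∀ x : Γ, Continuous (act x)
  gpb : B → B → ℝ
  gpx : Γ → B → ℝ
  gpb_symm : ∀ ξ η : B, gpb ξ η = gpb η ξ
  gpb_nonneg : ∀ ξ η : B, 0 ≤ gpb ξ η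
  gpx_nonneg : ∀ (x : Γ) (ξ : B), 0 ≤ gpx x ξ
  gpb_cont : ContinuousOn (fun p : B × B => gpb p.1 p.2) {p : B × B | p.1 ≠ p.2}
  gpx_cont : ∀ x : Γ, Continuous (gpx x)
  hyp : ∃ δ : ℝ, 0 ≤ δ ∧
    (∀ ξ η ζ : B, min (gpb ξ ζ) (gpb ζ η) - δ ≤ gpb ξ η) ∧
    (∀ (x : Γ) (ξ η : B), min (gpx x ξ) (gpb ξ η) - δ ≤ gpx x η) ∧
    (∀ (x y : Γ) (ξ : B), min (gromov d 1 x y) (gpx y ξ) - δ ≤ gpx x ξ)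
  at_infinity : ∀ (ξ : B) (M : ℝ), ∃ x : Γ, M ≤ gpx x ξ
  conformal : ∃ C : ℝ, 0 ≤ C ∧ ∀ (x : Γ) (ξ η : B), ξ ≠ η →
    |((d 1 x - 2 * gpx x ξ) + (d 1 x - 2 * gpx x η))
        - (2 * gpb (act x⁻¹ ξ) (act x⁻¹ η) - 2 * gpb ξ η)| ≤ C

variable {B : Type*}

/-- The boundary square `∂²Γ`: pairs of distinct boundary points. -/
abbrev B2 (B : Type*) := {p : B × B // p.1 ≠ p.2}

/-- Busemann cocycle for a strongly hyperbolic metric: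
`b_o(x, ξ) = d(o, x) - 2⟨x|ξ⟩_o`. -/
def busemann [Group Γ] {d : Γ → Γ → ℝ} [TopologicalSpace B]
    (bd : BoundaryData Γ d B) (x : Γ) (ξ : B) : ℝ :=
  d 1 x - 2 * bd.gpx x ξ

/-- Busemann function of a general metric `d ∈ 𝒟_Γ`:
`b_o(x, ξ) = sup { limsup_n (d(x, z_n) - d(o, z_n)) : z_n → ξ }`. -/
def busemannSup [Group Γ] {d : Γ → Γ → ℝ} [TopologicalSpace B]
    (bd : BoundaryData Γ d B) (x : Γ) (ξ : B) : ℝ :=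
  sSup {t : ℝ | ∃ z : ℕ → Γ,
    Tendsto (fun n => bd.gpx (z n) ξ) atTop atTop ∧
    t = limsup (fun n => d x (z n) - d 1 (z n)) atTop}

open Classical in
/-- The gauge `ρ(ξ, η) = exp(-(ξ|η)_o)` on the boundary. -/
def gaugeB [Group Γ] {d : Γ → Γ → ℝ} [TopologicalSpace B]
    (bd : BoundaryData Γ d B) (ξ η : B) : ℝ :=
  if ξ = η then 0 else Real.exp (-(bd.gpb ξ η))

/-- The max-gauge `ρ_×` on the boundary square. -/
def gaugeX [Group Γ] {d : Γ → Γ → ℝ} [TopologicalSpace B]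
    (bd : BoundaryData Γ d B) (p q : B2 B) : ℝ :=
  max (gaugeB bd p.1.1 q.1.1) (gaugeB bd p.1.2 q.1.2)

/-- Diagonal action of `Γ` on the boundary square. -/
def BoundaryData.dact [Group Γ] {d : Γ → Γ → ℝ} [TopologicalSpace B]
    (bd : BoundaryData Γ d B) (g : Γ) (p : B2 B) : B2 B :=
  ⟨(bd.act g p.1.1, bd.act g p.1.2), fun h => p.2 (by
    have h' : bd.act g p.1.1 = bd.act g p.1.2 := h
    have h2 : ∀ ξ : B, bd.act g⁻¹ (bd.act g ξ) = ξ := fun ξ => by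
      rw [← bd.act_mul, inv_mul_cancel, bd.act_one]
    have h3 := congrArg (bd.act g⁻¹) h'
    rwa [h2, h2] at h3)⟩

/-- Patterson–Sullivan property: quasi-conformal density of dimension `gr(d)` with
respect to the Busemann function `bus`. -/
def IsPS [Group Γ] [TopologicalSpace B] [MeasurableSpace B] {d : Γ → Γ → ℝ}
    (bd : BoundaryData Γ d B) (bus : Γ → B → ℝ) (μ : Measure B) : Prop :=
  IsProbabilityMeasure μ ∧ ∃ C : ℝ, 1 ≤ C ∧ ∀ x : Γ,
    Measure.map (bd.act x) μ
        ≤ μ.withDensity (fun ξ => ENNReal.ofReal (C * Real.exp (-(growthRate d) * bus x ξ))) ∧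
    μ.withDensity (fun ξ => ENNReal.ofReal (C⁻¹ * Real.exp (-(growthRate d) * bus x ξ)))
        ≤ Measure.map (bd.act x) μ

/-- Product measure on the boundary square (restriction of `μ ⊗ ν` off the diagonal). -/
def prodB2 [TopologicalSpace B] [MeasurableSpace B] (μ ν : Measure B) : Measure (B2 B) :=
  Measure.comap Subtype.val (μ.prod ν)

/-- The Bowen–Margulis current `exp(2·gr(d)·⟨ξ|η⟩_o)·(μ ⊗ μ)` on `∂²Γ`. -/
def bmCurrent [Group Γ] [TopologicalSpace B] [MeasurableSpace B] {d : Γ → Γ → ℝ}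
    (bd : BoundaryData Γ d B) (μ : Measure B) : Measure (B2 B) :=
  (prodB2 μ μ).withDensity
    (fun p => ENNReal.ofReal (Real.exp (2 * growthRate d * bd.gpb p.1.1 p.1.2)))

/-! ## The topological flow space -/

/-- The cocycle `α(x, ξ, η) = (b_o(x⁻¹, ξ) - b_o(x⁻¹, η))/2`. -/
def alphaC [Group Γ] [TopologicalSpace B] {d : Γ → Γ → ℝ}
    (bd : BoundaryData Γ d B) (x : Γ) (p : B2 B) : ℝ :=
  (busemann bd x⁻¹ p.1.1 - busemann bd x⁻¹ p.1.2) / 2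

/-- The `(Γ, α)`-action on `∂²Γ × ℝ`:
`x·(ξ, η, t) = (xξ, xη, t - α(x, ξ, η))`. -/
def gact [Group Γ] [TopologicalSpace B] {d : Γ → Γ → ℝ}
    (bd : BoundaryData Γ d B) (x : Γ) : B2 B × ℝ → B2 B × ℝ :=
  fun q => (bd.dact x q.1, q.2 - alphaC bd x q.1)

/-- Orbit relation of the `(Γ, α)`-action. -/
def orbitRel [Group Γ] [TopologicalSpace B] {d : Γ → Γ → ℝ}
    (bd : BoundaryData Γ d B) : (B2 B × ℝ) → (B2 B × ℝ) → Prop :=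
  fun p q => ∃ x : Γ, gact bd x p = q

/-- The topological flow space `ℱ_α = Γ \ (∂²Γ × ℝ)`. -/
abbrev FlowSpace [Group Γ] [TopologicalSpace B] {d : Γ → Γ → ℝ}
    (bd : BoundaryData Γ d B) :=
  Quot (orbitRel bd)

/-- The topological flow `Φ_t` on `ℱ_α` induced by translation in the `ℝ`-coordinate. -/
def flowQ [Group Γ] [TopologicalSpace B] {d : Γ → Γ → ℝ}
    (bd : BoundaryData Γ d B) (t : ℝ) : FlowSpace bd → FlowSpace bd :=
  Quot.map (fun p => (p.1, p.2 + t)) (by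
    rintro p q ⟨x, rfl⟩
    refine ⟨x, ?_⟩
    have h4 : p.2 + t - alphaC bd x p.1 = p.2 - alphaC bd x p.1 + t := by ring
    exact congrArg (Prod.mk (bd.dact x p.1)) h4)

/-- Representative of a point of a quotient. -/
def qout {α : Type*} {r : α → α → Prop} (q : Quot r) : α :=
  (Quot.exists_rep q).choose

/-! ## Automatic structures and symbolic dynamics -/

/-- A finite labelled directed graph (automaton) over the alphabet `S ⊆ Γ`. -/
structure Automaton (Γ : Type*) (S : Set Γ) where
  V : Type
  E : Type
  fintypeV : Fintype V
  fintypeE : Fintype E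
  src : E → V
  tgt : E → V
  init : V
  lab : E → Γ
  lab_mem : ∀ e, lab e ∈ S

attribute [instance] Automaton.fintypeV Automaton.fintypeE

namespace Automaton

variable {S : Set Γ}

/-- A list of edges is a directed path. -/
def Chain (A : Automaton Γ S) : List A.E → Prop
  | [] => True
  | [_] => True
  | e :: e' :: l => A.tgt e = A.src e' ∧ Chain A (e' :: l)

/-- A path starts at the initial state. -/
def FromInit (A : Automaton Γ S) (l : List A.E) : Prop :=
  ∀ h : l ≠ [], A.src (l.head h) = A.init

/-- The group element labelled by a path. -/
def pathProd [Group Γ] (A : Automaton Γ S) (l : List A.E) : Γ :=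
  (l.map A.lab).prod

/-- A path stays in the set of vertices `W`. -/
def ChainIn (A : Automaton Γ S) (W : Set A.V) (l : List A.E) : Prop :=
  A.Chain l ∧ ∀ e ∈ l, A.src e ∈ W ∧ A.tgt e ∈ W

/-- `w` can be reached from `v` by a directed path inside `W`. -/
def Reaches (A : Automaton Γ S) (W : Set A.V) (v w : A.V) : Prop :=
  v = w ∨ ∃ (l : List A.E) (h : l ≠ []), A.ChainIn W l ∧
    A.src (l.head h) = v ∧ A.tgt (l.getLast h) = w

/-- The subgraph on `W` is recurrent. -/
def IsRecurrentOn (A : Automaton Γ S) (W : Set A.V) : Prop :=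
  ∀ v ∈ W, ∀ w ∈ W, A.Reaches W v w

/-- A component: a maximal recurrent subgraph. -/
def IsComponent (A : Automaton Γ S) (W : Set A.V) : Prop :=
  W.Nonempty ∧ A.IsRecurrentOn W ∧
    ∀ W' : Set A.V, W ⊆ W' → A.IsRecurrentOn W' → W' = W

end Automaton

/-- A strongly Markov automatic structure (Cannon): all vertices are reachable from the
initial state, paths label geodesics in the Cayley graph, and evaluation is a bijection
from directed paths from the initial state onto `Γ`. -/
structure IsStronglyMarkov [Group Γ] {S : Set Γ} (A : Automaton Γ S) : Prop where
  reach : ∀ v : A.V, ∃ l : List A.E, A.Chain l ∧ A.FromInit l ∧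
    ((l = [] ∧ v = A.init) ∨ ∃ h : l ≠ [], A.tgt (l.getLast h) = v)
  geodesic : ∀ l : List A.E, A.Chain l → wordLength S (A.pathProd l) = l.length
  endpoint_bij : Function.Bijective
    (fun l : {l : List A.E // A.Chain l ∧ A.FromInit l} => A.pathProd l.1)

instance {S : Set Γ} (A : Automaton Γ S) : MeasurableSpace A.E := ⊤
instance {S : Set Γ} (A : Automaton Γ S) : TopologicalSpace A.E := ⊥

/-- The two-sided subshift of finite type of bi-infinite directed paths in `A`. -/
abbrev BiPath {S : Set Γ} (A : Automaton Γ S) :=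
  {ω : ℤ → A.E // ∀ i : ℤ, A.tgt (ω i) = A.src (ω (i + 1))}

/-- The shift `σ` on bi-infinite paths. -/
def shiftB {S : Set Γ} (A : Automaton Γ S) (ω : BiPath A) : BiPath A :=
  ⟨fun i => ω.1 (i + 1), fun i => ω.2 (i + 1)⟩

open Classical in
/-- The metric `d_Σ(ω, ω') = e^{-n}`, `n = sup{k : ω_i = ω'_i for |i| ≤ k}`. -/
def dSigma {S : Set Γ} {A : Automaton Γ S} (ω ω' : BiPath A) : ℝ :=
  if ω = ω' then 0
  else Real.exp (-((sSup {k : ℕ | ∀ i : ℤ, |i| ≤ (k : ℤ) → ω.1 i = ω'.1 i} : ℕ) : ℝ))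

/-- Partial products along the positive ray of a bi-infinite path. -/
def rayPos [Group Γ] {S : Set Γ} (A : Automaton Γ S) (ω : BiPath A) (n : ℕ) : Γ :=
  ((List.range n).map fun i => A.lab (ω.1 (i : ℤ))).prod

/-- Partial products along the negative ray of a bi-infinite path. -/
def rayNeg [Group Γ] {S : Set Γ} (A : Automaton Γ S) (ω : BiPath A) (n : ℕ) : Γ :=
  ((List.range n).map fun i => (A.lab (ω.1 (-(i : ℤ) - 1)))⁻¹).prod

/-- `wst` is the endpoint map `w_* : Σ → ∂²Γ`: the two labelled geodesic rays of a
bi-infinite path converge to the two components of `wst ω` (convergence to a boundary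
point being expressed by divergence of the Gromov product). -/
def IsEndpointMap [Group Γ] {S : Set Γ} (A : Automaton Γ S) [TopologicalSpace B]
    {d : Γ → Γ → ℝ} (bd : BoundaryData Γ d B) (wst : BiPath A → B2 B) : Prop :=
  ∀ ω : BiPath A,
    Tendsto (fun n : ℕ => bd.gpx (rayNeg A ω n) (wst ω).1.1) atTop atTop ∧
    Tendsto (fun n : ℕ => bd.gpx (rayPos A ω n) (wst ω).1.2) atTop atTop

/-- The function `α̃(ω) = α(w(ω₀)⁻¹, w_*(ω))` on the shift space. -/
def alphaTilde [Group Γ] {S : Set Γ} (A : Automaton Γ S) [TopologicalSpace B]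
    {d : Γ → Γ → ℝ} (bd : BoundaryData Γ d B) (wst : BiPath A → B2 B)
    (ω : BiPath A) : ℝ :=
  alphaC bd (A.lab (ω.1 0))⁻¹ (wst ω)

/-- Birkhoff sums on the two-sided shift. -/
def birkhoffB {S : Set Γ} (A : Automaton Γ S) (f : BiPath A → ℝ) (N : ℕ)
    (ω : BiPath A) : ℝ :=
  ∑ i ∈ Finset.range N, f ((shiftB A)^[i] ω)

/-- The identification generating the suspension flow:
`(ω, t + r(ω)) ∼ (σ^N ω, t)`. -/
def susRel {S : Set Γ} (A : Automaton Γ S) (r : BiPath A → ℝ) (N : ℕ) :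
    (BiPath A × ℝ) → (BiPath A × ℝ) → Prop :=
  fun p q => q.1 = (shiftB A)^[N] p.1 ∧ q.2 = p.2 - r p.1

/-- The suspension space `Sus(Σ, r)`. -/
abbrev Sus {S : Set Γ} (A : Automaton Γ S) (r : BiPath A → ℝ) (N : ℕ) :=
  Quot (susRel A r N)

/-- The suspension flow `σ_t [ω, s] = [ω, s + t]`. -/
def susFlow {S : Set Γ} (A : Automaton Γ S) (r : BiPath A → ℝ) (N : ℕ) (t : ℝ) :
    Sus A r N → Sus A r N :=
  Quot.map (fun p => (p.1, p.2 + t)) (by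
    rintro p q ⟨h1, h2⟩
    have h3 : q.2 + t = (p.2 + t) - r p.1 := by rw [h2]; ring
    exact ⟨h1, h3⟩)

/-- The set `Σ_𝒞` of bi-infinite paths staying in the component `W` for all time. -/
def SigmaC {S : Set Γ} (A : Automaton Γ S) (W : Set A.V) : Set (BiPath A) :=
  {ω | ∀ i : ℤ, A.src (ω.1 i) ∈ W}

/-- The cylinder in `Σ_𝒞` determined by a finite word. -/
def cylSet {S : Set Γ} (A : Automaton Γ S) (W : Set A.V) (n : ℕ)
    (w : Fin n → A.E) : Set (BiPath A) :=
  {ω | ω ∈ SigmaC A W ∧ ∀ i : Fin n, ω.1 ((i : ℕ) : ℤ) = w i}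

/-- The cylinder of length `n` of a given bi-infinite path (coordinates `0, …, n-1`). -/
def cylPos {S : Set Γ} (A : Automaton Γ S) (n : ℕ) (ω : BiPath A) :
    Set (BiPath A) :=
  {ω' | ∀ i : ℕ, i < n → ω'.1 (i : ℤ) = ω.1 (i : ℤ)}

/-- The pressure of a potential on the component `W` of the two-sided shift, via
partition sums over cylinders. -/
def prC {S : Set Γ} (A : Automaton Γ S) (W : Set A.V) (ψ : BiPath A → ℝ) : ℝ :=
  limsup (fun n : ℕ =>
    Real.log (∑' w : {w : Fin n → A.E // (cylSet A W n w).Nonempty},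
      Real.exp (sSup (birkhoffB A ψ n '' cylSet A W n w.1))) / (n : ℝ)) atTop

/-- Birkhoff sums of a potential on finite unilateral paths. -/
def finBirk {S : Set Γ} (A : Automaton Γ S) (φ : List A.E → ℝ) (l : List A.E) : ℝ :=
  ∑ k ∈ Finset.range l.length, φ (l.drop k)

/-- The pressure (logarithm of the maximal modulus of the eigenvalues of the transfer
operator `ℒ_φ` restricted to the component `W`), expressed through the partition sums
over finite paths staying in `W`. -/
def prCfin {S : Set Γ} (A : Automaton Γ S) (W : Set A.V) (φ : List A.E → ℝ) : ℝ :=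
  limsup (fun n : ℕ =>
    Real.log (∑' l : {l : List A.E // A.ChainIn W l ∧ l.length = n},
      Real.exp (finBirk A φ l.1)) / (n : ℝ)) atTop

/-- The potential `b̃` on finite unilateral paths:
`b̃(ω) = b̂_o(w(ω₀), w_* ω) = d(w(ω₀), w_* ω) - d(o, w_* ω)`. -/
def potB [Group Γ] {S : Set Γ} (A : Automaton Γ S) (d : Γ → Γ → ℝ) :
    List A.E → ℝ
  | [] => 0
  | e :: l' => d (A.lab e) (A.pathProd (e :: l')) - d 1 (A.pathProd (e :: l'))

/-! ## Kolmogorov–Sinai entropy -/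

/-- A finite measurable partition. -/
def IsFinPartition {X : Type*} [MeasurableSpace X] {k : ℕ} (P : Fin k → Set X) : Prop :=
  (∀ i, MeasurableSet (P i)) ∧ Pairwise (Function.onFun Disjoint P) ∧
    (⋃ i, P i) = Set.univ

/-- Entropy of a finite partition. -/
def partEnt {X : Type*} [MeasurableSpace X] {ι : Type*} [Fintype ι]
    (ν : Measure X) (P : ι → Set X) : ℝ :=
  -∑ i, ((ν (P i)).toReal * Real.log (ν (P i)).toReal)

/-- The join `⋁_{i<n} T^{-i} P`. -/
def joinPart {X : Type*} (T : X → X) {k : ℕ} (P : Fin k → Set X) (n : ℕ)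
    (f : Fin n → Fin k) : Set X :=
  ⋂ i : Fin n, T^[(i : ℕ)] ⁻¹' P (f i)

/-- Kolmogorov–Sinai (measure-theoretic) entropy of `T` with respect to `ν`. -/
def ksEntropy {X : Type*} [MeasurableSpace X] (T : X → X) (ν : Measure X) : ℝ :=
  sSup {h : ℝ | ∃ (k : ℕ) (P : Fin k → Set X), IsFinPartition P ∧
    h = liminf (fun n : ℕ => partEnt ν (joinPart T P n) / (n : ℝ)) atTop}

end HypFlow

end

namespace HypFlow

section Lengths

variable {Γ : Type*} [Group Γ]

/-- A proper geodesic length function on a group, with values in `ℕ`. -/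
structure IsLen (ℓ : Γ → ℕ) : Prop where
  one : ℓ 1 = 0
  eq_one : ∀ x, ℓ x = 0 → x = 1
  inv : ∀ x, ℓ x⁻¹ = ℓ x
  mul_le : ∀ x y, ℓ (x * y) ≤ ℓ x + ℓ y
  geod : ∀ x, ∃ y : ℕ → Γ, y 0 = 1 ∧ y (ℓ x) = x ∧ ∀ i, ℓ ((y i)⁻¹ * y (i + 1)) ≤ 1
  fin : ∀ n, {x | ℓ x ≤ n}.Finite

theorem IsSymmGen.exists_list {S : Set Γ} (hS : IsSymmGen S) (x : Γ) :
    ∃ l : List Γ, (∀ a ∈ l, a ∈ S) ∧ l.prod = x := by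
  have hx : x ∈ Subgroup.closure S := by rw [hS.2.2]; trivial
  induction hx using Subgroup.closure_induction with
  | mem x hx => exact ⟨[x], by simpa using hx, by simp⟩
  | one => exact ⟨[], by simp, by simp⟩
  | mul x y _ _ ihx ihy =>
    obtain ⟨l, hl, rfl⟩ := ihx
    obtain ⟨l', hl', rfl⟩ := ihy
    refine ⟨l ++ l', fun a ha => ?_, by simp⟩
    rcases List.mem_append.1 ha with h | h
    exacts [hl a h, hl' a h]
  | inv x _ ih =>
    obtain ⟨l, hl, rfl⟩ := ih
    refine ⟨(l.map (·⁻¹)).reverse, fun a ha => ?_, by rw [List.prod_inv_reverse]⟩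
    simp only [List.mem_reverse, List.mem_map] at ha
    obtain ⟨b, hb, rfl⟩ := ha
    exact hS.2.1 b (hl b hb)

theorem wordLength_prod_le {S : Set Γ} (l : List Γ) (hl : ∀ a ∈ l, a ∈ S) :
    wordLength S l.prod ≤ l.length :=
  Nat.sInf_le ⟨l, hl, rfl, rfl⟩

theorem IsSymmGen.exists_list_length {S : Set Γ} (hS : IsSymmGen S) (x : Γ) :
    ∃ l : List Γ, (∀ a ∈ l, a ∈ S) ∧ l.length = wordLength S x ∧ l.prod = x := by
  obtain ⟨l, hl, hx⟩ := hS.exists_list x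
  exact Nat.sInf_mem (s := {n : ℕ | ∃ l : List Γ, (∀ a ∈ l, a ∈ S) ∧ l.length = n ∧ l.prod = x})
    ⟨l.length, l, hl, rfl, hx⟩

theorem IsSymmGen.isLen {S : Set Γ} (hS : IsSymmGen S) : IsLen (wordLength S) where
  one := by simpa using wordLength_prod_le (S := S) [] (by simp)
  eq_one x hx := by
    obtain ⟨l, -, hl, rfl⟩ := hS.exists_list_length x
    rw [hx, List.length_eq_zero_iff] at hl
    simp [hl]
  inv := by
    have key : ∀ x, wordLength S x⁻¹ ≤ wordLength S x := by
      intro x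
      obtain ⟨l, hl, hn, rfl⟩ := hS.exists_list_length x
      rw [← hn, List.prod_inv_reverse]
      refine (wordLength_prod_le _ fun a ha => ?_).trans (by simp)
      simp only [List.mem_reverse, List.mem_map] at ha
      obtain ⟨b, hb, rfl⟩ := ha
      exact hS.2.1 b (hl b hb)
    exact fun x => le_antisymm (key x) (by simpa using key x⁻¹)
  mul_le x y := by
    obtain ⟨l, hl, hn, rfl⟩ := hS.exists_list_length x
    obtain ⟨l', hl', hn', rfl⟩ := hS.exists_list_length y
    rw [← hn, ← hn', ← List.prod_append, ← List.length_append]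
    refine wordLength_prod_le _ fun a ha => ?_
    rcases List.mem_append.1 ha with h | h
    exacts [hl a h, hl' a h]
  geod x := by
    obtain ⟨l, hl, hn, rfl⟩ := hS.exists_list_length x
    refine ⟨fun i => (l.take i).prod, by simp, by simp [← hn], fun i => ?_⟩
    rcases lt_or_ge i l.length with h | h
    · have : (l.take i).prod⁻¹ * (l.take (i + 1)).prod = [l[i]].prod := by
        rw [List.prod_take_succ l i h]; simp
      simp only [this]
      exact wordLength_prod_le _ (by simp [hl])
    · have h1 : l.take i = l := List.take_of_length_le h
      have h2 : l.take (i + 1) = l := List.take_of_length_le (by omega)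
      simp only [h1, h2, inv_mul_cancel]
      exact (wordLength_prod_le (S := S) [] (by simp)).trans (by simp)
  fin := by
    have key : ∀ n, {x : Γ | ∃ l : List Γ, (∀ a ∈ l, a ∈ S) ∧ l.length = n ∧ l.prod = x}.Finite := by
      intro n
      induction n with
      | zero =>
        refine (Set.finite_singleton (1 : Γ)).subset ?_
        rintro x ⟨l, -, hl, rfl⟩
        simp [List.length_eq_zero_iff.1 hl]
      | succ n ih =>
        refine (hS.1.image2 (· * ·) ih).subset ?_
        rintro x ⟨l, h, hl, rfl⟩
        cases l with
        | nil => simp at hl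
        | cons a l =>
          exact ⟨a, h a (by simp), l.prod,
            ⟨l, fun b hb => h b (by simp [hb]), by simpa using hl, rfl⟩, by simp⟩
    intro n
    refine ((Set.finite_Iic n).biUnion fun k _ => key k).subset ?_
    intro x hx
    simp only [Set.mem_iUnion]
    exact ⟨wordLength S x, hx, hS.exists_list_length x⟩

namespace IsLen

variable {ℓ ℓ' : Γ → ℕ}

theorem dist_comm (h : IsLen ℓ) (x y : Γ) : ℓ (x⁻¹ * y) = ℓ (y⁻¹ * x) := by
  rw [← h.inv (x⁻¹ * y)]; simp

theorem dist_triangle (h : IsLen ℓ) (x y z : Γ) : ℓ (x⁻¹ * z) ≤ ℓ (x⁻¹ * y) + ℓ (y⁻¹ * z) := by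
  have := h.mul_le (x⁻¹ * y) (y⁻¹ * z)
  simpa [mul_assoc] using this

theorem le_add_dist (h : IsLen ℓ) (x y : Γ) : ℓ x ≤ ℓ y + ℓ (x⁻¹ * y) := by
  have := h.mul_le y (y⁻¹ * x)
  rw [h.dist_comm y x] at this
  simpa using this

theorem exists_geodesic (h : IsLen ℓ) (x : Γ) :
    ∃ y : ℕ → Γ, y 0 = 1 ∧ y (ℓ x) = x ∧
      ∀ i j, i ≤ j → j ≤ ℓ x → ℓ ((y i)⁻¹ * y j) = j - i := by
  obtain ⟨y, h0, h1, hy⟩ := h.geod x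
  have key : ∀ i k, ℓ ((y i)⁻¹ * y (i + k)) ≤ k := by
    intro i k
    induction k with
    | zero => simp [h.one]
    | succ k ih =>
      have := h.dist_triangle (y i) (y (i + k)) (y (i + (k + 1)))
      have := hy (i + k)
      rw [add_assoc] at this
      omega
  refine ⟨y, h0, h1, fun i j hij hj => ?_⟩
  have a1 := key 0 i
  have a2 := key i (j - i)
  have a3 := key j (ℓ x - j)
  have b1 := h.dist_triangle 1 (y i) (y (ℓ x))
  have b2 := h.dist_triangle (y i) (y j) (y (ℓ x))
  rw [show i + (j - i) = j by omega] at a2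
  rw [show j + (ℓ x - j) = ℓ x by omega] at a3
  simp only [zero_add, h0, h1, inv_one, one_mul] at *
  omega

theorem exists_split (h : IsLen ℓ) (x : Γ) {n : ℕ} (hn : n ≤ ℓ x) :
    ∃ p q, x = p * q ∧ ℓ p = n ∧ ℓ q = ℓ x - n := by
  obtain ⟨y, h0, h1, hy⟩ := h.exists_geodesic x
  refine ⟨y n, (y n)⁻¹ * x, by simp, ?_, ?_⟩
  · simpa [h0] using hy 0 n (by omega) hn
  · simpa [h1] using hy n (ℓ x) hn le_rfl

theorem exists_lipschitz (h : IsLen ℓ) (h' : IsLen ℓ') : ∃ L, ∀ x, ℓ' x ≤ L * ℓ x := by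
  obtain ⟨L, hL⟩ := ((h.fin 1).image ℓ').bddAbove
  refine ⟨L, fun x => ?_⟩
  obtain ⟨y, h0, h1, hy⟩ := h.geod x
  have key : ∀ k, ℓ' (y k) ≤ L * k := by
    intro k
    induction k with
    | zero => simp [h0, h'.one]
    | succ k ih =>
      have e1 := h'.mul_le (y k) ((y k)⁻¹ * y (k + 1))
      have e2 : ℓ' ((y k)⁻¹ * y (k + 1)) ≤ L := hL ⟨_, hy k, rfl⟩
      rw [mul_inv_cancel_left] at e1
      rw [Nat.mul_succ]
      omega
  simpa [h1] using key (ℓ x)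

end IsLen

end Lengths

end HypFlow

namespace HypFlow

section Morse

variable {Γ : Type*} [Group Γ] {ℓ ℓ' : Γ → ℕ} {δ : ℕ}

/-- Twice the Gromov product based at the identity. -/
def gp (ℓ : Γ → ℕ) (x y : Γ) : ℤ := ℓ x + ℓ y - ℓ (x⁻¹ * y)

/-- Four-point hyperbolicity of a length function. -/
def IsHyp (ℓ : Γ → ℕ) (δ : ℕ) : Prop := ∀ x y z, min (gp ℓ x z) (gp ℓ z y) - δ ≤ gp ℓ x y

/-- The concatenation of `x` and `y` is geodesic up to the error `D`. -/
def Aligned (ℓ : Γ → ℕ) (D : ℕ) (x y : Γ) : Prop := ℓ x + ℓ y ≤ ℓ (x * y) + D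

theorem IsHyperbolicMetric.exists_isHyp {S : Set Γ}
    (h : IsHyperbolicMetric (wordDist S)) : ∃ δ, IsHyp (wordLength S) δ := by
  obtain ⟨δ, -, h⟩ := h
  refine ⟨⌈2 * δ⌉₊, fun x y z => ?_⟩
  have h1 := h 1 x y z
  have h2 := Nat.le_ceil (2 * δ)
  have key : ∀ a b, gromov (wordDist S) 1 a b = (gp (wordLength S) a b : ℝ) / 2 := by
    intro a b
    simp [gromov, wordDist, gp]
  simp only [key] at h1
  have : ((min (gp (wordLength S) x z) (gp (wordLength S) z y) - (⌈2 * δ⌉₊ : ℕ) : ℤ) : ℝ) ≤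
      (gp (wordLength S) x y : ℤ) := by
    push_cast
    rw [min_div_div_right (by norm_num)] at h1
    linarith
  exact_mod_cast this

theorem gp_comm (h : IsLen ℓ) (x y : Γ) : gp ℓ x y = gp ℓ y x := by
  unfold gp; rw [h.dist_comm x y]; ring

theorem gp_chain (hyp : IsHyp ℓ δ) (c : ℤ) (u : ℕ → Γ) (k : ℕ) : ∀ a n, 1 ≤ n → n ≤ 2 ^ k →
    (∀ i, a ≤ i → i < a + n → c ≤ gp ℓ (u i) (u (i + 1))) →
    c - k * δ ≤ gp ℓ (u a) (u (a + n)) := by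
  induction k with
  | zero =>
    intro a n h1 h2 h3
    obtain rfl : n = 1 := by simp at h2; omega
    simpa using h3 a le_rfl (by omega)
  | succ k ih =>
    intro a n h1 h2 h3
    have hp := pow_succ 2 k
    have hδ : ((k + 1 : ℕ) : ℤ) * δ = k * δ + δ := by push_cast; ring
    rcases le_or_gt n (2 ^ k) with hn | hn
    · have := ih a n h1 hn h3
      rw [hδ]; omega
    · have e1 := ih a (2 ^ k) Nat.one_le_two_pow le_rfl fun i hi hi' => h3 i hi (by omega)
      have e2 := ih (a + 2 ^ k) (n - 2 ^ k) (by omega) (by omega)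
        fun i hi hi' => h3 i (by omega) (by omega)
      rw [show a + 2 ^ k + (n - 2 ^ k) = a + n by omega] at e2
      have e3 := hyp (u a) (u (a + n)) (u (a + 2 ^ k))
      rw [hδ]; omega

theorem linear_le_two_pow (A B q : ℕ) (hq : 4 + A + B ≤ q) : A * q + B ≤ 2 ^ q := by
  have h1 : ∀ q, 4 ≤ q → q ^ 2 ≤ 2 ^ q := by
    intro q hq
    induction q, hq using Nat.le_induction with
    | base => norm_num
    | succ q hq ih => rw [pow_succ 2 q]; nlinarith
  have h2 := h1 q (by omega)
  nlinarith

/-- Points of a geodesic are uniformly close to any quasi-geodesic with the same endpoints. -/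
theorem IsHyp.geodesic_near_path (h : IsLen ℓ) (hyp : IsHyp ℓ δ) (L C : ℕ) :
    ∃ R₀, ∀ (x : ℕ → Γ) (n : ℕ) (y : ℕ → Γ) (m : ℕ),
      (∀ i < n, ℓ ((x i)⁻¹ * x (i + 1)) ≤ L) →
      (∀ i k, i ≤ k → k ≤ n → k - i ≤ L * ℓ ((x i)⁻¹ * x k) + C) →
      y 0 = x 0 → y m = x n →
      (∀ i j, i ≤ j → j ≤ m → ℓ ((y i)⁻¹ * y j) = j - i) →
      ∀ j ≤ m, ∃ i ≤ n, ℓ ((y j)⁻¹ * x i) ≤ R₀ := by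
  refine ⟨(δ + 1) * (L + 2 * δ + 4 + 6 * L * (δ + 1) + 6 * L * (δ + 1) + C + 1),
    fun x n y m hx hq h0 hm hy => ?_⟩
  have hD : ∀ j, ∃ i ≤ n, ∀ k ≤ n, ℓ ((y j)⁻¹ * x i) ≤ ℓ ((y j)⁻¹ * x k) := by
    intro j
    obtain ⟨i, hi, h⟩ := Finset.exists_min_image (Finset.range (n + 1))
      (fun i => ℓ ((y j)⁻¹ * x i)) ⟨0, by simp⟩
    exact ⟨i, by simpa [Nat.lt_succ_iff] using hi,
      fun k hk => h k (by simpa [Nat.lt_succ_iff] using hk)⟩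
  choose c hcn hc using hD
  obtain ⟨j, hj, hmax⟩ := Finset.exists_max_image (Finset.range (m + 1))
    (fun j => ℓ ((y j)⁻¹ * x (c j))) ⟨0, by simp⟩
  replace hj : j ≤ m := by simpa [Nat.lt_succ_iff] using hj
  replace hmax : ∀ i ≤ m, ℓ ((y i)⁻¹ * x (c i)) ≤ ℓ ((y j)⁻¹ * x (c j)) :=
    fun i hi => hmax i (by simpa [Nat.lt_succ_iff] using hi)
  suffices hR : ℓ ((y j)⁻¹ * x (c j)) ≤
      (δ + 1) * (L + 2 * δ + 4 + 6 * L * (δ + 1) + 6 * L * (δ + 1) + C + 1) from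
    fun i hi => ⟨c i, hcn i, (hmax i hi).trans hR⟩
  set R := ℓ ((y j)⁻¹ * x (c j)) with hRdef
  set p := y j with hp
  have hfar : ∀ i ≤ n, R ≤ ℓ (p⁻¹ * x i) := fun i hi => hc j i hi
  have gpd : ∀ u v, gp ℓ (p⁻¹ * u) (p⁻¹ * v) = ℓ (p⁻¹ * u) + ℓ (p⁻¹ * v) - ℓ (u⁻¹ * v) := by
    intro u v
    simp [gp, mul_assoc]
  have right : ∃ j₁ k₁, j ≤ j₁ ∧ j₁ ≤ j + 2 * R ∧ j₁ ≤ m ∧ k₁ ≤ n ∧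
      ℓ ((y j₁)⁻¹ * x k₁) ≤ R ∧ (2 * R : ℤ) ≤ gp ℓ (p⁻¹ * y j₁) (p⁻¹ * x k₁) := by
    rcases le_or_gt (j + 2 * R) m with hc1 | hc1
    · refine ⟨j + 2 * R, c (j + 2 * R), by omega, le_rfl, hc1, hcn _, hmax _ hc1, ?_⟩
      have e1 : ℓ (p⁻¹ * y (j + 2 * R)) = _ := hy j (j + 2 * R) (by omega) hc1
      have e2 := hmax _ hc1
      have e3 := hfar _ (hcn (j + 2 * R))
      rw [gpd]
      omega
    · refine ⟨m, n, hj, by omega, le_rfl, le_rfl, by simp [hm, h.one], ?_⟩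
      have e3 := hfar n le_rfl
      rw [gpd, hm, inv_mul_cancel, h.one]
      omega
  have left : ∃ j₁ k₁, j₁ ≤ j ∧ j ≤ j₁ + 2 * R ∧ k₁ ≤ n ∧
      ℓ ((y j₁)⁻¹ * x k₁) ≤ R ∧ (2 * R : ℤ) ≤ gp ℓ (p⁻¹ * y j₁) (p⁻¹ * x k₁) := by
    rcases le_or_gt (2 * R) j with hc1 | hc1
    · refine ⟨j - 2 * R, c (j - 2 * R), by omega, by omega, hcn _, hmax _ (by omega), ?_⟩
      have e1 : ℓ (_ * p) = _ := hy (j - 2 * R) j (by omega) hj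
      rw [h.dist_comm] at e1
      have e2 := hmax (j - 2 * R) (by omega)
      have e3 := hfar _ (hcn (j - 2 * R))
      rw [gpd]
      omega
    · refine ⟨0, 0, by omega, by omega, by omega, by simp [h0, h.one], ?_⟩
      have e3 := hfar 0 (by omega)
      rw [gpd, h0, inv_mul_cancel, h.one]
      omega
  obtain ⟨a, k, ha1, ha2, hk, hak, hgl⟩ := left
  obtain ⟨b, l, hb1, hb2, hbm, hl, hbl, hgr⟩ := right
  by_contra! hbig
  set q := R / (δ + 1) with hqdef
  have hq1 : (δ + 1) * q ≤ R := Nat.mul_div_le R (δ + 1)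
  have hq2 : R < (δ + 1) * (q + 1) := by
    have := Nat.lt_mul_div_succ R (Nat.succ_pos δ)
    simpa using this
  have hq3 : L + 2 * δ + 4 + 6 * L * (δ + 1) + 6 * L * (δ + 1) + C + 1 ≤ q := by
    rw [hqdef, Nat.le_div_iff_mul_le (Nat.succ_pos δ), mul_comm]
    exact hbig.le
  have hpow := linear_le_two_pow (6 * L * (δ + 1)) (6 * L * (δ + 1) + C + 1) q (by omega)
  have hRq : q * δ + q ≤ R := by nlinarith
  have hdist : ∀ i k, i ≤ k → k ≤ n → ℓ ((x i)⁻¹ * x k) ≤ 6 * R → k - i + 1 ≤ 2 ^ q := by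
    intro i k hik hk hd
    have e1 := hq i k hik hk
    have e2 : L * ℓ ((x i)⁻¹ * x k) ≤ L * (6 * R) := Nat.mul_le_mul_left _ hd
    have e3 : L * (6 * R) ≤ L * (6 * ((δ + 1) * (q + 1))) := by gcongr
    have e4 : L * (6 * ((δ + 1) * (q + 1))) = 6 * L * (δ + 1) * q + 6 * L * (δ + 1) := by ring
    omega
  have hchain : ∀ i k, i ≤ k → k ≤ n → ℓ ((x i)⁻¹ * x k) ≤ 6 * R →
      (2 * R - L - q * δ : ℤ) ≤ gp ℓ (p⁻¹ * x i) (p⁻¹ * x k) := by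
    intro i k hik hk hd
    rcases hik.eq_or_lt with rfl | hlt
    · have := hfar i hk
      rw [gpd, inv_mul_cancel, h.one]
      have : (0 : ℤ) ≤ q * δ := by positivity
      omega
    · have := gp_chain hyp (2 * R - L) (fun i => p⁻¹ * x i) q i (k - i) (by omega)
        (by have := hdist i k hik hk hd; omega) fun r hr hr' => by
          have e1 := hfar r (by omega)
          have e2 := hfar (r + 1) (by omega)
          have e3 := hx r (by omega)
          rw [gpd]
          omega
      rwa [show i + (k - i) = k by omega] at this
  have hkl : ℓ ((x k)⁻¹ * x l) ≤ 6 * R := by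
    have e1 := h.dist_triangle (x k) (y a) (x l)
    have e2 := h.dist_triangle (y a) (y b) (x l)
    have e3 := hy a b (by omega) hbm
    rw [h.dist_comm (x k) (y a)] at e1
    omega
  have hmid : (2 * R - L - q * δ : ℤ) ≤ gp ℓ (p⁻¹ * x k) (p⁻¹ * x l) := by
    rcases le_total k l with hkl' | hkl'
    · exact hchain k l hkl' hl hkl
    · rw [gp_comm h]
      exact hchain l k hkl' hk (by rwa [h.dist_comm])
  have z0 : gp ℓ (p⁻¹ * y a) (p⁻¹ * y b) = 0 := by
    have e1 : ℓ (_ * p) = _ := hy a j ha1 hj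
    have e2 : ℓ (p⁻¹ * y b) = _ := hy j b hb1 hbm
    have e3 := hy a b (by omega) hbm
    rw [h.dist_comm] at e1
    rw [gpd]
    omega
  have f1 := hyp (p⁻¹ * y a) (p⁻¹ * y b) (p⁻¹ * x k)
  have f2 := hyp (p⁻¹ * x k) (p⁻¹ * y b) (p⁻¹ * x l)
  rw [gp_comm h (p⁻¹ * y b)] at hgr
  replace hq3 : L + 2 * δ + 1 ≤ q := by omega
  zify at hRq
  have : (0 : ℤ) ≤ q * δ := by positivity
  omega

/-- Points of a quasi-geodesic are uniformly close to any geodesic with the same endpoints. -/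
theorem IsHyp.path_near_geodesic (h : IsLen ℓ) (hyp : IsHyp ℓ δ) (L C : ℕ) :
    ∃ R₁, ∀ (x : ℕ → Γ) (n : ℕ) (y : ℕ → Γ) (m : ℕ),
      (∀ i < n, ℓ ((x i)⁻¹ * x (i + 1)) ≤ L) →
      (∀ i k, i ≤ k → k ≤ n → k - i ≤ L * ℓ ((x i)⁻¹ * x k) + C) →
      y 0 = x 0 → y m = x n →
      (∀ i j, i ≤ j → j ≤ m → ℓ ((y i)⁻¹ * y j) = j - i) →
      ∀ l ≤ n, ∃ j ≤ m, ℓ ((x l)⁻¹ * y j) ≤ R₁ := by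
  obtain ⟨R, hR⟩ := hyp.geodesic_near_path h L C
  refine ⟨L * (L * (2 * R + 1) + C) + R, fun x n y m hx hq h0 hm hy l hl => ?_⟩
  have near := hR x n y m hx hq h0 hm hy
  have steps : ∀ i k, i + k ≤ n → ℓ ((x i)⁻¹ * x (i + k)) ≤ L * k := by
    intro i k
    induction k with
    | zero => simp [h.one]
    | succ k ih =>
      intro hik
      have e1 := ih (by omega)
      have e2 := h.dist_triangle (x i) (x (i + k)) (x (i + (k + 1)))
      have e3 := hx (i + k) (by omega)
      rw [add_assoc] at e3
      rw [Nat.mul_succ]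
      omega
  have key : ∃ j ≤ m, ∃ i ≤ l, ∃ k, l ≤ k ∧ k ≤ n ∧ ℓ ((y j)⁻¹ * x i) ≤ R ∧
      ℓ ((y j)⁻¹ * x k) ≤ R + 1 := by
    by_contra! hcon
    have all : ∀ j ≤ m, ∃ i ≤ l, ℓ ((y j)⁻¹ * x i) ≤ R := by
      intro j
      induction j with
      | zero => exact fun _ => ⟨0, by omega, by simp [h0, h.one]⟩
      | succ j ih =>
        intro hj
        obtain ⟨i, hi, hi'⟩ := ih (by omega)
        obtain ⟨k, hk, hk'⟩ := near (j + 1) hj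
        rcases le_total k l with hkl | hkl
        · exact ⟨k, hkl, hk'⟩
        · have e1 := hcon j (by omega) i hi k hkl hk hi'
          have e2 := h.dist_triangle (y j) (y (j + 1)) (x k)
          have e3 := hy j (j + 1) (by omega) hj
          omega
    obtain ⟨i, hi, hi'⟩ := all m le_rfl
    have := hcon m le_rfl i hi n hl le_rfl hi'
    simp [hm, h.one] at this
  obtain ⟨j, hj, i, hi, k, hk, hkn, e1, e2⟩ := key
  refine ⟨j, hj, ?_⟩
  have e3 := hq i k (by omega) hkn
  have e4 := h.dist_triangle (x i) (y j) (x k)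
  rw [h.dist_comm (x i) (y j)] at e4
  have e5 : L * ℓ ((x i)⁻¹ * x k) ≤ L * (2 * R + 1) := Nat.mul_le_mul_left _ (by omega)
  have e6 := steps i (l - i) (by omega)
  rw [show i + (l - i) = l by omega] at e6
  have e7 : L * (l - i) ≤ L * (L * (2 * R + 1) + C) := Nat.mul_le_mul_left _ (by omega)
  have e8 := h.dist_triangle (x l) (x i) (y j)
  rw [h.dist_comm (x l) (x i), h.dist_comm (x i) (y j)] at e8
  omega

theorem IsHyp.aligned_of_aligned (h : IsLen ℓ) (hyp : IsHyp ℓ δ) (h' : IsLen ℓ') (D : ℕ) :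
    ∃ D', ∀ x z, Aligned ℓ' D x z → Aligned ℓ D' x z := by
  obtain ⟨L₁, hL₁⟩ := h'.exists_lipschitz h
  obtain ⟨L₂, hL₂⟩ := h.exists_lipschitz h'
  obtain ⟨R, hR⟩ := hyp.path_near_geodesic h (L₁ + L₂) D
  refine ⟨2 * R, fun x z hxz => ?_⟩
  obtain ⟨u, u0, u1, hu⟩ := h'.geod x
  obtain ⟨v, v0, v1, hv⟩ := h'.geod z
  obtain ⟨y, y0, y1, hy⟩ := h.exists_geodesic (x * z)
  set X : ℕ → Γ := fun i => if i ≤ ℓ' x then u i else x * v (i - ℓ' x) with hX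
  have X0 : X 0 = 1 := by simp [hX, u0]
  have Xx : X (ℓ' x) = x := by simp [hX, u1]
  have Xn : X (ℓ' x + ℓ' z) = x * z := by
    simp only [hX]
    split_ifs with hc
    · have hz : ℓ' z = 0 := by omega
      rw [hz, add_zero, u1, h'.eq_one z hz, mul_one]
    · simp [v1]
  have Xs : ∀ i, ℓ' ((X i)⁻¹ * X (i + 1)) ≤ 1 := by
    intro i
    simp only [hX]
    split_ifs with c1 c2
    · exact hu i
    · have : i = ℓ' x := by omega
      subst this
      have := hv 0
      rw [v0] at this
      simpa [u1] using this
    · omega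
    · have := hv (i - ℓ' x)
      rw [show i + 1 - ℓ' x = i - ℓ' x + 1 by omega]
      simpa [mul_assoc] using this
  have key : ∀ i k, ℓ' ((X i)⁻¹ * X (i + k)) ≤ k := by
    intro i k
    induction k with
    | zero => simp [h'.one]
    | succ k ih =>
      have := h'.dist_triangle (X i) (X (i + k)) (X (i + (k + 1)))
      have := Xs (i + k)
      rw [add_assoc] at this
      omega
  obtain ⟨j, hj, hjR⟩ := hR X (ℓ' x + ℓ' z) y (ℓ (x * z))
    (fun i _ => (hL₁ _).trans (by have := Xs i; nlinarith))
    (fun i k hik hk => by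
      have a1 := key 0 i
      have a3 := key k (ℓ' x + ℓ' z - k)
      have b1 := h'.dist_triangle 1 (X i) (X (ℓ' x + ℓ' z))
      have b2 := h'.dist_triangle (X i) (X k) (X (ℓ' x + ℓ' z))
      rw [show k + (ℓ' x + ℓ' z - k) = ℓ' x + ℓ' z by omega] at a3
      simp only [zero_add, X0, Xn, inv_one, one_mul] at *
      have c1 := hL₂ ((X i)⁻¹ * X k)
      have c2 : (L₁ + L₂) * ℓ ((X i)⁻¹ * X k) =
        L₁ * ℓ ((X i)⁻¹ * X k) + L₂ * ℓ ((X i)⁻¹ * X k) := by ring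
      have c3 : ℓ' x + ℓ' z ≤ ℓ' (x * z) + D := hxz
      omega)
    (by rw [y0, X0]) (by rw [y1, Xn]) hy (ℓ' x) (by omega)
  rw [Xx] at hjR
  have e1 := hy 0 j (by omega) hj
  have e2 := hy j (ℓ (x * z)) hj le_rfl
  have e3 := h.le_add_dist x (y j)
  have e4 := h.dist_triangle x (y j) (x * z)
  simp only [y0, y1, inv_one, one_mul, inv_mul_cancel_left] at e1 e2 e4
  unfold Aligned
  omega

theorem IsHyp.aligned_of_aligned' (h : IsLen ℓ) (hyp : IsHyp ℓ δ) (h' : IsLen ℓ') (D : ℕ) :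
    ∃ D', ∀ x z, Aligned ℓ D x z → Aligned ℓ' D' x z := by
  obtain ⟨L₁, hL₁⟩ := h'.exists_lipschitz h
  obtain ⟨L₂, hL₂⟩ := h.exists_lipschitz h'
  obtain ⟨R, hR⟩ := hyp.geodesic_near_path h (L₁ + L₂) 0
  refine ⟨2 * (L₂ * (2 * D + δ + R)), fun x z hxz => ?_⟩
  unfold Aligned at hxz
  obtain ⟨X, X0, X1, hX⟩ := h'.exists_geodesic (x * z)
  obtain ⟨y, y0, y1, hy⟩ := h.exists_geodesic (x * z)
  obtain ⟨i, hi, hiR⟩ := hR X (ℓ' (x * z)) y (ℓ (x * z))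
    (fun i hi => (hL₁ _).trans (by
      have := hX i (i + 1) (by omega) hi
      rw [show i + 1 - i = 1 by omega] at this
      rw [this]; omega))
    (fun i k hik hk => by
      have c1 := hL₂ ((X i)⁻¹ * X k)
      have c2 : (L₁ + L₂) * ℓ ((X i)⁻¹ * X k) =
        L₁ * ℓ ((X i)⁻¹ * X k) + L₂ * ℓ ((X i)⁻¹ * X k) := by ring
      have := hX i k hik hk
      omega)
    (by rw [y0, X0]) (by rw [y1, X1]) hy (min (ℓ x) (ℓ (x * z))) (min_le_right _ _)
  set j := min (ℓ x) (ℓ (x * z)) with hj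
  have e1 := hy 0 j (by omega) (by omega)
  have e2 := hy j (ℓ (x * z)) (by omega) le_rfl
  simp only [y0, y1, inv_one, one_mul] at e1 e2
  have e3 := hyp x (y j) (x * z)
  rw [gp_comm h (x * z)] at e3
  simp only [gp, inv_mul_cancel_left] at e3
  have e4 := h.dist_triangle x (y j) (X i)
  have e5 := hL₂ (x⁻¹ * X i)
  have e6 : L₂ * ℓ (x⁻¹ * X i) ≤ L₂ * (2 * D + δ + R) := Nat.mul_le_mul_left _ (by omega)
  have f1 := hX 0 i (by omega) hi
  have f2 := hX i (ℓ' (x * z)) hi le_rfl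
  have f3 := h'.le_add_dist x (X i)
  have f4 := h'.dist_triangle x (X i) (x * z)
  simp only [X0, X1, inv_one, one_mul, inv_mul_cancel_left] at f1 f2 f4
  unfold Aligned
  omega

end Morse

end HypFlow

namespace HypFlow

section Connecting

variable {Γ : Type*} [Group Γ] {ℓ ℓ' : Γ → ℕ} {δ : ℕ}

/-- A group with a proper integer-valued quasi-morphism is virtually cyclic. -/
theorem virtuallyCyclic_of_quasimorphism (β : Γ → ℤ)
    (hβ : ∀ g h, |β (g * h) - β g - β h| ≤ δ) (hfin : ∀ C, {g | |β g| ≤ C}.Finite) :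
    VirtuallyCyclic Γ := by
  by_cases hΓ : Finite Γ
  · exact ⟨Subgroup.zpowers 1, inferInstance, 1, rfl⟩
  have hg : ∃ g, 2 * δ < β g := by
    by_contra! hcon
    refine hΓ (Set.finite_univ_iff.1 ((hfin (4 * δ)).subset fun g _ => ?_))
    have e1 := hβ g g⁻¹
    have e2 := hβ 1 1
    have e3 := hcon g
    have e4 := hcon g⁻¹
    simp only [mul_inv_cancel, mul_one, Set.mem_ofPred_eq, abs_le] at *
    omega
  obtain ⟨g, hg⟩ := hg
  have descend : ∀ n : ℕ, ∀ h, (β h).natAbs ≤ n → ∃ k : ℤ, |β (g ^ k * h)| ≤ β g + δ := by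
    intro n
    induction n with
    | zero =>
      intro h hn
      refine ⟨0, ?_⟩
      simp only [zpow_zero, one_mul, abs_le]
      omega
    | succ n ih =>
      intro h hn
      rcases le_or_gt |β h| (β g + δ) with hle | hlt
      · exact ⟨0, by simpa using hle⟩
      · rcases lt_abs.1 hlt with hpos | hneg
        · have e := hβ g (g⁻¹ * h)
          rw [mul_inv_cancel_left, abs_le] at e
          obtain ⟨k, hk⟩ := ih (g⁻¹ * h) (by omega)
          refine ⟨k - 1, ?_⟩
          rwa [zpow_sub_one, mul_assoc]
        · have e := hβ g h
          rw [abs_le] at e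
          obtain ⟨k, hk⟩ := ih (g * h) (by omega)
          refine ⟨k + 1, ?_⟩
          rwa [zpow_add_one, mul_assoc]
  refine ⟨Subgroup.zpowers g, ?_, g, rfl⟩
  have : Finite (Γ ⧸ Subgroup.zpowers g) := by
    refine Set.finite_univ_iff.1 (((hfin (β g + δ)).image
      fun x => ((x⁻¹ : Γ) : Γ ⧸ Subgroup.zpowers g)).subset fun x _ => ?_)
    obtain ⟨h, rfl⟩ := QuotientGroup.mk_surjective x
    obtain ⟨k, hk⟩ := descend _ h⁻¹ le_rfl
    refine ⟨_, hk, ?_⟩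
    rw [QuotientGroup.eq]
    exact ⟨k, by simp⟩
  exact Subgroup.finiteIndex_of_finite_quotient

theorem IsHyp.abs_gp_sub_le (hyp : IsHyp ℓ δ) (h : IsLen ℓ) {g b b' : Γ}
    (hb : 2 * ℓ g ≤ gp ℓ b b') :
    |(ℓ (g * b') - ℓ b' : ℤ) - (ℓ (g * b) - ℓ b)| ≤ δ := by
  have e1 := hyp g⁻¹ b' b
  have e2 := hyp g⁻¹ b b'
  rw [gp_comm h b' b] at e2
  have e3 := h.dist_triangle 1 g⁻¹ b
  have e4 := h.le_add_dist b g⁻¹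
  have e5 := h.le_add_dist b' g⁻¹
  rw [h.dist_comm] at e4 e5
  simp only [gp, inv_inv, h.inv] at *
  rw [abs_le]
  omega

/-- If some element is nearly fixed towards infinity by all of `Γ`, then `Γ` is
virtually cyclic. -/
theorem IsHyp.virtuallyCyclic (hyp : IsHyp ℓ δ) (h : IsLen ℓ) (b : ℕ → Γ)
    (hb : ∀ n c, ℓ c ≤ n → (2 * n : ℤ) ≤ gp ℓ (b n) (c * b n)) : VirtuallyCyclic Γ := by
  have hex : ∀ g, ∃ v : ℤ, ∀ᶠ n in (Filter.hyperfilter ℕ : Filter ℕ),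
      (ℓ (g * b n) - ℓ (b n) : ℤ) = v := by
    intro g
    have hfin : (Set.Icc (-ℓ g : ℤ) (ℓ g)).Finite := Set.finite_Icc _ _
    have : ∀ᶠ n in (Filter.hyperfilter ℕ : Filter ℕ), ∃ v ∈ Set.Icc (-ℓ g : ℤ) (ℓ g),
        (ℓ (g * b n) - ℓ (b n) : ℤ) = v := by
      refine Filter.Eventually.of_forall fun n => ⟨_, ?_, rfl⟩
      have e1 := h.mul_le g (b n)
      have e2 := h.mul_le g⁻¹ (g * b n)
      rw [h.inv, inv_mul_cancel_left] at e2
      constructor <;> omega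
    obtain ⟨v, -, hv⟩ := (Ultrafilter.eventually_exists_mem_iff hfin).1 this
    exact ⟨v, hv⟩
  choose β hβ using hex
  have large : ∀ m : ℕ, ∀ᶠ n in (Filter.hyperfilter ℕ : Filter ℕ), m ≤ n := fun m =>
    Nat.hyperfilter_le_atTop (Filter.eventually_ge_atTop m)
  refine virtuallyCyclic_of_quasimorphism (δ := δ) β (fun g k => ?_) fun C => ?_
  · obtain ⟨n, e1, e2, e3, e4, e5⟩ := ((hβ (g * k)).and ((hβ g).and ((hβ k).and
      ((large (ℓ g)).and (large (ℓ k)))))).exists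
    have := hyp.abs_gp_sub_le h (g := g) (b := b n) (b' := k * b n)
      (by have := hb n k e5; omega)
    rw [← e1, ← e2, ← e3, mul_assoc]
    convert this using 2
    ring
  · by_contra hinf
    set B := (h.fin (3 * C + 4 * δ).toNat).toFinset with hB
    obtain ⟨G, hG, hcard⟩ := Set.Infinite.exists_subset_card_eq hinf (B.card + 1)
    set t := G.sup ℓ with ht
    obtain ⟨n, hn, hnt⟩ := (((Filter.eventually_all_finset G).2 fun g _ => hβ g).and
      (large t)).exists
    have hnb := hb n 1 (by simp [h.one])
    simp only [gp, one_mul, inv_mul_cancel, h.one] at hnb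
    obtain ⟨r, q, hrq, hr, hq⟩ := h.exists_split (b n) (n := t) (by omega)
    have hle : G.card ≤ B.card := by
      refine Finset.card_le_card_of_injOn (fun g => r⁻¹ * g * r) (fun g hg => ?_)
        fun x _ y _ hxy => by simpa using hxy
      have hgt : ℓ g ≤ t := Finset.le_sup hg
      have hgC : |β g| ≤ C := hG hg
      have hgn := hn g hg
      have hbg := hb n g (by omega)
      rw [hrq] at hgn hbg
      have e0 : gp ℓ r (r * q) = 2 * t := by
        rw [← hrq]
        simp only [gp, hrq, inv_mul_cancel_left]
        rw [← hrq]
        omega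
      have e1 := hyp.abs_gp_sub_le h (g := g) (b := r) (b' := r * q) (by omega)
      have e2 := hyp r (g * r) (r * q)
      have e3 := hyp (r * q) (g * r) (g * (r * q))
      have e4 : gp ℓ (g * (r * q)) (g * r) = ℓ (g * (r * q)) + ℓ (g * r) - ℓ q := by
        rw [gp, ← h.inv q]
        simp
      have e5 : gp ℓ r (g * r) = ℓ r + ℓ (g * r) - ℓ (r⁻¹ * g * r) := by
        simp [gp, mul_assoc]
      have e6 : ℓ (r * q) = t + ℓ q := by rw [← hrq]; omega
      simp only [hB, Set.Finite.coe_toFinset, Set.mem_ofPred_eq]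
      rw [abs_le] at e1 hgC
      omega
    omega

/-- Two elements can be concatenated almost geodesically after inserting a bounded element. -/
theorem IsHyp.exists_connecting (hyp : IsHyp ℓ δ) (h : IsLen ℓ) (hΓ : ¬ VirtuallyCyclic Γ) :
    ∃ D, ∀ x z, ∃ c, ℓ c ≤ D ∧ Aligned ℓ D x (c * z) := by
  by_contra! hcon
  choose x z hxz using hcon
  refine hΓ (hyp.virtuallyCyclic h (fun n => z (2 * n + δ)) fun n c hc => ?_)
  have e1 := hxz (2 * n + δ) 1 (by simp [h.one])
  have e2 := hxz (2 * n + δ) c (by omega)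
  have e3 := hyp (z (2 * n + δ)) (c * z (2 * n + δ)) (x (2 * n + δ))⁻¹
  rw [gp_comm h (z (2 * n + δ)) (x (2 * n + δ))⁻¹] at e3
  simp only [Aligned, not_le, one_mul] at e1 e2
  simp only [gp, inv_inv, h.inv] at e3 ⊢
  omega

theorem IsHyp.exists_connecting' (hyp : IsHyp ℓ δ) (h : IsLen ℓ) (hΓ : ¬ VirtuallyCyclic Γ)
    (h' : IsLen ℓ') : ∃ D, ∀ x z, ∃ c, ℓ' c ≤ D ∧ Aligned ℓ' D x (c * z) := by
  obtain ⟨D, hD⟩ := hyp.exists_connecting h hΓ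
  obtain ⟨D', hD'⟩ := hyp.aligned_of_aligned' h h' D
  obtain ⟨L, hL⟩ := h.exists_lipschitz h'
  refine ⟨L * D + D', fun x z => ?_⟩
  obtain ⟨c, hc, hal⟩ := hD x z
  refine ⟨c, ?_, ?_⟩
  · have := (hL c).trans (Nat.mul_le_mul_left L hc)
    omega
  · have := hD' _ _ hal
    unfold Aligned at this ⊢
    omega

end Connecting

end HypFlow

namespace HypFlow

section Pairs

variable {Γ : Type*} [Group Γ] {ℓ ℓ' f : Γ → ℕ} {δ : ℕ}

/-- The coarse geometry of two word lengths on a non-elementary hyperbolic group: `ℓ` is the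
length organizing the spheres, `f` the length being compared with it. -/
structure IsHypPair (ℓ f : Γ → ℕ) : Prop where
  len : IsLen ℓ
  mul_le : ∀ x y, f (x * y) ≤ f x + f y
  lipschitz : ∃ L, ∀ x, f x ≤ L * ℓ x
  add_le : ∀ D, ∃ K, ∀ x y, Aligned ℓ D x y → f x + f y ≤ f (x * y) + K
  track : ∀ D, ∃ K, ∀ p u q v, Aligned ℓ D p u → Aligned ℓ D q v → p * u = q * v →
    ℓ p ≤ ℓ q + D → ℓ q ≤ ℓ p + D → ℓ (p⁻¹ * q) ≤ K
  connect : ∃ D, ∀ x z, ∃ c, ℓ c ≤ D ∧ Aligned ℓ D x (c * z)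
  infinite : Infinite Γ

theorem IsHyp.exists_track (hyp : IsHyp ℓ δ) (h : IsLen ℓ) (h' : IsLen ℓ') (D : ℕ) :
    ∃ K, ∀ p u q v, Aligned ℓ' D p u → Aligned ℓ' D q v → p * u = q * v →
      ℓ' p ≤ ℓ' q + D → ℓ' q ≤ ℓ' p + D → ℓ' (p⁻¹ * q) ≤ K := by
  obtain ⟨D₁, hD₁⟩ := hyp.aligned_of_aligned h h' D
  obtain ⟨D₂, hD₂⟩ := hyp.aligned_of_aligned' h h' (D₁ + δ)
  have key : ∀ p u q v, Aligned ℓ' D p u → Aligned ℓ' D q v → p * u = q * v →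
      ℓ' q ≤ ℓ' p + D → ℓ p ≤ ℓ q → ℓ' (p⁻¹ * q) ≤ D + D₂ := by
    intro p u q v hp hq huv hpq hle
    have e1 := hyp p q (p * u)
    have e2 := hD₁ _ _ hp
    have e3 := hD₁ _ _ hq
    unfold Aligned at e2 e3
    rw [huv] at e1 e2
    have e4 : gp ℓ p (q * v) = ℓ p + ℓ (q * v) - ℓ u := by simp [gp, ← huv]
    have e5 : gp ℓ (q * v) q = ℓ (q * v) + ℓ q - ℓ v := by
      rw [gp_comm h]
      simp only [gp, inv_mul_cancel_left]
      ring
    have e6 : gp ℓ p q = ℓ p + ℓ q - ℓ (p⁻¹ * q) := rfl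
    have e7 := hD₂ p (p⁻¹ * q) (by unfold Aligned; rw [mul_inv_cancel_left]; omega)
    unfold Aligned at e7
    rw [mul_inv_cancel_left] at e7
    omega
  refine ⟨D + D₂, fun p u q v hp hq huv h1 h2 => ?_⟩
  rcases le_total (ℓ p) (ℓ q) with hle | hle
  · exact key p u q v hp hq huv h2 hle
  · rw [h'.dist_comm p q]
    exact key q v p u hq hp huv.symm h1 hle

theorem IsHypPair.of_isHyp (hyp : IsHyp ℓ δ) (h : IsLen ℓ) (hΓ : ¬ VirtuallyCyclic Γ)
    (h' : IsLen ℓ') (hf : IsLen f) : IsHypPair ℓ' f where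
  len := h'
  mul_le := hf.mul_le
  lipschitz := h'.exists_lipschitz hf
  add_le D := by
    obtain ⟨D₁, hD₁⟩ := hyp.aligned_of_aligned h h' D
    obtain ⟨D₂, hD₂⟩ := hyp.aligned_of_aligned' h hf D₁
    exact ⟨D₂, fun x y hxy => hD₂ x y (hD₁ x y hxy)⟩
  track := hyp.exists_track h h'
  connect := hyp.exists_connecting' h hΓ h'
  infinite := by
    by_contra hfin
    rw [not_infinite_iff_finite] at hfin
    exact hΓ ⟨Subgroup.zpowers 1, inferInstance, 1, rfl⟩

end Pairs

end HypFlow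

namespace HypFlow

section Counting

variable {Γ : Type*} [Group Γ] {ℓ f : Γ → ℕ}

/-- `p` lies on a geodesic from the identity to `g`. -/
def IsPrefix (ℓ : Γ → ℕ) (p g : Γ) : Prop := ℓ p + ℓ (p⁻¹ * g) = ℓ g

theorem IsPrefix.le {p g : Γ} (hp : IsPrefix ℓ p g) : ℓ p ≤ ℓ g := by
  unfold IsPrefix at hp; omega

theorem IsPrefix.aligned {p g : Γ} (hp : IsPrefix ℓ p g) (D : ℕ) :
    Aligned ℓ D p (p⁻¹ * g) := by
  unfold IsPrefix at hp
  unfold Aligned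
  rw [mul_inv_cancel_left]
  omega

theorem IsPrefix.trans (h : IsLen ℓ) {p q g : Γ} (hp : IsPrefix ℓ p q) (hq : IsPrefix ℓ q g) :
    IsPrefix ℓ p g := by
  have e1 := h.dist_triangle p q g
  have e2 := h.mul_le p (p⁻¹ * g)
  rw [mul_inv_cancel_left] at e2
  unfold IsPrefix at *
  omega

namespace IsLen

theorem exists_prefix (h : IsLen ℓ) (g : Γ) {n : ℕ} (hn : n ≤ ℓ g) :
    ∃ p, IsPrefix ℓ p g ∧ ℓ p = n := by
  obtain ⟨p, q, rfl, hp, hq⟩ := h.exists_split g hn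
  refine ⟨p, ?_, hp⟩
  unfold IsPrefix
  rw [inv_mul_cancel_left]
  omega

/-- The ball of radius `n` around the identity. -/
noncomputable def ball (h : IsLen ℓ) (n : ℕ) : Finset Γ := (h.fin n).toFinset

/-- The sphere of radius `n` around the identity. -/
noncomputable def sphere (h : IsLen ℓ) (n : ℕ) : Finset Γ := (h.ball n).filter (ℓ · = n)

@[simp] theorem mem_ball (h : IsLen ℓ) {n : ℕ} {x : Γ} : x ∈ h.ball n ↔ ℓ x ≤ n := by
  simp [ball]

@[simp] theorem mem_sphere (h : IsLen ℓ) {n : ℕ} {x : Γ} : x ∈ h.sphere n ↔ ℓ x = n := by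
  simp only [sphere, Finset.mem_filter, mem_ball]
  omega

theorem sphere_nonempty [Infinite Γ] (h : IsLen ℓ) (n : ℕ) : (h.sphere n).Nonempty := by
  obtain ⟨x, hx⟩ := (h.fin n).infinite_compl.nonempty
  simp only [Set.mem_compl_iff, Set.mem_ofPred_eq, not_le] at hx
  obtain ⟨p, -, hp⟩ := h.exists_prefix x hx.le
  exact ⟨p, by simpa using hp⟩

theorem card_sphere_add_le (h : IsLen ℓ) (n m : ℕ) :
    (h.sphere (n + m)).card ≤ (h.sphere n).card * (h.sphere m).card := by
  classical
  rw [← Finset.card_product]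
  refine (Finset.card_le_card fun x hx => ?_).trans
    (Finset.card_image_le (f := fun a : Γ × Γ => a.1 * a.2))
  rw [mem_sphere] at hx
  obtain ⟨p, q, rfl, hp, hq⟩ := h.exists_split x (n := n) (by omega)
  exact Finset.mem_image.2 ⟨(p, q), by simp [hp, hq, hx], rfl⟩

end IsLen

namespace IsHypPair

/-- Pairs of elements of two spheres can be concatenated with bounded multiplicity. -/
theorem exists_card_le (hp : IsHypPair ℓ f) : ∃ D C : ℕ, ∀ (n m : ℕ) (A : Finset (Γ × Γ))
    (Y : Finset Γ), (∀ a ∈ A, ℓ a.1 = n ∧ ℓ a.2 = m) → D ≤ n + m →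
    (∀ a ∈ A, ∀ y c, ℓ c ≤ D → Aligned ℓ D a.1 (c * a.2) → ℓ y + D = n + m →
      IsPrefix ℓ y (a.1 * (c * a.2)) → y ∈ Y) → A.card ≤ C * Y.card := by
  obtain ⟨D, hD⟩ := hp.connect
  obtain ⟨K, hK⟩ := hp.track (2 * D)
  have h := hp.len
  refine ⟨2 * D, (h.ball K).card * (h.ball (3 * D)).card * (h.ball D).card,
    fun n m A Y hA hnm hY => ?_⟩
  choose c hc hal using hD
  have e0 : ∀ a ∈ A, n + m ≤ ℓ (a.1 * (c a.1 a.2 * a.2)) + 2 * D := by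
    intro a ha
    have e1 := hal a.1 a.2
    have e2 := h.mul_le (c a.1 a.2)⁻¹ (c a.1 a.2 * a.2)
    rw [inv_mul_cancel_left, h.inv] at e2
    have := hA a ha
    have := hc a.1 a.2
    unfold Aligned at e1
    omega
  have e1 : ∀ a : Γ × Γ, ∃ y, a ∈ A → IsPrefix ℓ y (a.1 * (c a.1 a.2 * a.2)) ∧
      ℓ y = n + m - 2 * D := by
    intro a
    by_cases ha : a ∈ A
    · obtain ⟨y, hy⟩ := h.exists_prefix (a.1 * (c a.1 a.2 * a.2)) (n := n + m - 2 * D)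
        (by have := e0 a ha; omega)
      exact ⟨y, fun _ => hy⟩
    · exact ⟨1, fun h => absurd h ha⟩
  choose y hy using e1
  have e2 : ∀ v : Γ, ∃ u, IsPrefix ℓ u v ∧ ℓ u = min n (ℓ v) :=
    fun v => h.exists_prefix v (min_le_right _ _)
  choose u hu hul using e2
  have e3 : A.card ≤ (Y ×ˢ (h.ball K ×ˢ h.ball (3 * D) ×ˢ h.ball D)).card := by
    refine Finset.card_le_card_of_injOn (fun a => (y a, a.1⁻¹ * u (y a),
      (y a)⁻¹ * (a.1 * (c a.1 a.2 * a.2)), c a.1 a.2)) (fun a ha => ?_) ?_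
    · obtain ⟨h1, h2⟩ := hA a ha
      obtain ⟨h3, h4⟩ := hy a ha
      have h5 := hc a.1 a.2
      have h6 := h.mul_le a.1 (c a.1 a.2 * a.2)
      have h7 := h.mul_le (c a.1 a.2) a.2
      have h8 := hal a.1 a.2
      have h9 := hul (y a)
      simp only [Finset.coe_product, Set.mem_prod, Finset.mem_coe, IsLen.mem_ball]
      refine ⟨hY a ha _ _ (by omega) (h8.trans (by omega)) (by omega) h3, ?_, ?_, h5⟩
      · exact hK _ (c a.1 a.2 * a.2) _ _ (h8.trans (by omega))
          (((hu (y a)).trans h h3).aligned _) (by simp) (by omega) (by omega)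
      · unfold IsPrefix at h3
        omega
    · intro a _ b _ hab
      simp only [Prod.mk.injEq] at hab
      obtain ⟨h1, h2, h3, h4⟩ := hab
      rw [h1, mul_left_inj, inv_inj] at h2
      rw [h4, h1, h2] at h3
      exact Prod.ext h2 (by simpa using h3)
  simp only [Finset.card_product] at e3
  calc _ ≤ _ := e3
    _ = _ := by ring

/-- Growth of spheres is purely exponential up to constants. -/
theorem exists_card_sphere_le (hp : IsHypPair ℓ f) : ∃ C : ℕ, 0 < C ∧
    (∀ n k, (hp.len.sphere n).card ≤ C * (hp.len.sphere (n + k)).card) ∧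
    ∀ n m, (hp.len.sphere n).card * (hp.len.sphere m).card ≤
      C * (hp.len.sphere (n + m)).card := by
  obtain ⟨D, C, hC⟩ := hp.exists_card_le
  have := hp.infinite
  have pos : ∀ n, 1 ≤ (hp.len.sphere n).card := fun n => (hp.len.sphere_nonempty n).card_pos
  have key : ∀ n k, (hp.len.sphere n).card * (hp.len.sphere (k + D)).card ≤
      C * (hp.len.sphere (n + k)).card := by
    intro n k
    rw [← Finset.card_product]
    refine hC n (k + D) _ _ (fun a ha => by simpa using ha) (by omega) fun a ha y c _ _ hy _ => ?_
    rw [IsLen.mem_sphere]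
    omega
  have key' : ∀ n k, (hp.len.sphere n).card ≤ C * (hp.len.sphere (n + k)).card := fun n k =>
    (Nat.le_mul_of_pos_right _ (pos _)).trans (key n k)
  have hC0 : 0 < C := by
    have := (pos 0).trans (key' 0 0)
    exact Nat.pos_of_mul_pos_right this
  refine ⟨C * C, by positivity, fun n k => (key' n k).trans ?_, fun n m => ?_⟩
  · exact Nat.mul_le_mul_right _ (Nat.le_mul_of_pos_left _ hC0)
  · calc _ ≤ (hp.len.sphere n).card * (C * (hp.len.sphere (m + D)).card) :=
          Nat.mul_le_mul_left _ (key' m D)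
      _ = C * ((hp.len.sphere n).card * (hp.len.sphere (m + D)).card) := by ring
      _ ≤ C * (C * (hp.len.sphere (n + m)).card) := Nat.mul_le_mul_left _ (key n m)
      _ = _ := by ring

end IsHypPair

end Counting

end HypFlow

namespace HypFlow

section Slow

variable {Γ : Type*} [Group Γ] {ℓ f : Γ → ℕ}

open Classical in
/-- Elements of the sphere of radius `N` all of whose prefixes of length at least `m` have
`f`-length less than `s` times their length. -/
noncomputable def IsLen.slow (h : IsLen ℓ) (f : Γ → ℕ) (s : ℝ) (m N : ℕ) : Finset Γ :=
  (h.sphere N).filter fun z => ∀ p, IsPrefix ℓ p z → m ≤ ℓ p → (f p : ℝ) < s * ℓ p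

open Classical in
/-- Elements of the sphere of radius `M` whose `f`-length is at least `t * M`. -/
noncomputable def IsLen.fast (h : IsLen ℓ) (f : Γ → ℕ) (t : ℝ) (M : ℕ) : Finset Γ :=
  (h.sphere M).filter fun x => t * M ≤ f x

theorem IsLen.mem_slow (h : IsLen ℓ) {s : ℝ} {m N : ℕ} {z : Γ} : z ∈ h.slow f s m N ↔
    ℓ z = N ∧ ∀ p, IsPrefix ℓ p z → m ≤ ℓ p → (f p : ℝ) < s * ℓ p := by
  simp [slow]

theorem IsLen.mem_fast (h : IsLen ℓ) {t : ℝ} {M : ℕ} {x : Γ} :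
    x ∈ h.fast f t M ↔ ℓ x = M ∧ t * M ≤ f x := by
  simp [fast]

theorem IsLen.slow_subset_slow (h : IsLen ℓ) (f : Γ → ℕ) (s : ℝ) {m m' : ℕ} (hm : m ≤ m')
    (N : ℕ) : h.slow f s m N ⊆ h.slow f s m' N := by
  intro z hz
  rw [h.mem_slow] at hz ⊢
  exact ⟨hz.1, fun p hp hpm => hz.2 p hp (hm.trans hpm)⟩

theorem IsLen.card_slow_le (h : IsLen ℓ) (f : Γ → ℕ) (s : ℝ) (m N : ℕ) :
    (h.slow f s m N).card ≤ (h.sphere N).card :=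
  Finset.card_le_card fun _ hz => h.mem_sphere.2 (h.mem_slow.1 hz).1

theorem IsLen.card_slow_add_le (h : IsLen ℓ) (f : Γ → ℕ) (s : ℝ) (m N k : ℕ) :
    (h.slow f s m (N + k)).card ≤ (h.slow f s m N).card * (h.sphere k).card := by
  classical
  rw [← Finset.card_product]
  refine (Finset.card_le_card fun x hx => ?_).trans
    (Finset.card_image_le (f := fun a : Γ × Γ => a.1 * a.2))
  obtain ⟨hx, hxs⟩ := h.mem_slow.1 hx
  obtain ⟨p, hp, hpN⟩ := h.exists_prefix x (n := N) (by omega)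
  refine Finset.mem_image.2 ⟨(p, p⁻¹ * x), ?_, by simp⟩
  rw [Finset.mem_product, h.mem_slow, h.mem_sphere]
  refine ⟨⟨hpN, fun q hq => hxs q (hq.trans h hp)⟩, ?_⟩
  unfold IsPrefix at hp
  dsimp only
  omega

namespace IsHypPair

theorem exists_abs_sub_le (hp : IsHypPair ℓ f) :
    ∃ L : ℕ, (∀ x, f x ≤ L * ℓ x) ∧ ∀ x y, f x ≤ f y + L * ℓ (x⁻¹ * y) := by
  obtain ⟨L, hL⟩ := hp.lipschitz
  refine ⟨L, hL, fun x y => ?_⟩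
  have e1 := hp.mul_le y (y⁻¹ * x)
  have e2 := hL (y⁻¹ * x)
  rw [mul_inv_cancel_left] at e1
  rw [hp.len.dist_comm x y]
  omega

/-- Preceding a slow element by a fast one gives an element that is still eventually slow, but
not at the length of the fast one. -/
theorem exists_card_fast_mul_card_slow_le (hp : IsHypPair ℓ f) {s s' t : ℝ} (hs : 0 ≤ s)
    (hs' : s < s') (ht : s' < t) : ∃ D C M₀ : ℕ, ∀ M, M₀ ≤ M → ∀ m, ∃ m', M ≤ m' ∧ ∀ N,
      M ≤ N → ∀ Y : Finset Γ,
      (∀ y ∈ hp.len.slow f s' m' N, y ∉ hp.len.slow f s' M N → y ∈ Y) →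
      (hp.len.fast f t M).card * (hp.len.slow f s m (N - M + D)).card ≤ C * Y.card := by
  obtain ⟨D, C, hC⟩ := hp.exists_card_le
  obtain ⟨L, hL, hL'⟩ := hp.exists_abs_sub_le
  obtain ⟨K, hK⟩ := hp.track (3 * D)
  have h := hp.len
  obtain ⟨M₀, hM₀⟩ := exists_nat_gt (L * K / (t - s'))
  refine ⟨D, C, M₀, fun M hM m => ?_⟩
  obtain ⟨m₁, hm₁⟩ := exists_nat_gt (L * (M + D + K) / (s' - s))
  rw [div_lt_iff₀ (by linarith)] at hM₀ hm₁
  refine ⟨M + m + m₁, by omega, fun N hN Y hY => ?_⟩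
  rw [← Finset.card_product]
  refine hC M (N - M + D) _ _ (fun a ha => ?_) (by omega) ?_
  · rw [Finset.mem_product, h.mem_fast, h.mem_slow] at ha
    exact ⟨ha.1.1, ha.2.1⟩
  rintro ⟨x, z⟩ ha y c hc hal hy hpre
  rw [Finset.mem_product, h.mem_fast, h.mem_slow] at ha
  dsimp only at ha hal hpre
  obtain ⟨⟨hx, hxf⟩, hz, hzf⟩ := ha
  replace hy : ℓ y = N := by omega
  have hal' := hal
  unfold Aligned at hal'
  have hcz := h.mul_le c⁻¹ (c * z)
  rw [inv_mul_cancel_left, h.inv] at hcz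
  have hcz' := h.mul_le c z
  refine hY y (h.mem_slow.2 ⟨hy, fun p hpy hpm => ?_⟩) fun hslow => ?_
  · have hpg := hpy.trans h hpre
    have hpN := hpy.le
    obtain ⟨z', hz', hzl⟩ := h.exists_prefix z (n := ℓ p - M) (by omega)
    have e1 := hzf z' hz' (by omega)
    have hz'' := hz'
    unfold IsPrefix at hz''
    have e2 := h.mul_le (x * (c * z')) (z'⁻¹ * z)
    rw [show x * (c * z') * (z'⁻¹ * z) = x * (c * z) by group] at e2
    have e3 := h.mul_le x (c * z')
    have e4 := h.mul_le c z'
    have e5 := hK p (p⁻¹ * (x * (c * z))) (x * (c * z')) (z'⁻¹ * z) (hpg.aligned _)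
      (by
        unfold Aligned
        rw [show x * (c * z') * (z'⁻¹ * z) = x * (c * z) by group]
        omega) (by group) (by omega) (by omega)
    have e6 := hL' p (x * (c * z'))
    have e7 : f (x * (c * z')) ≤ L * M + L * D + f z' := by
      have a1 := hp.mul_le x (c * z')
      have a2 := hp.mul_le c z'
      have a3 := hL x
      have a4 := (hL c).trans (Nat.mul_le_mul_left L hc)
      rw [hx] at a3
      omega
    have e8 : f p ≤ L * (M + D + K) + f z' := by
      have := Nat.mul_le_mul_left L e5
      have : L * (M + D + K) = L * M + L * D + L * K := by ring
      omega
    have e9 : (f p : ℝ) ≤ L * (M + D + K) + f z' := by exact_mod_cast e8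
    have e10 : (ℓ z' : ℝ) ≤ ℓ p := by exact_mod_cast (by omega : ℓ z' ≤ ℓ p)
    have e11 : (m₁ : ℝ) ≤ ℓ p := by exact_mod_cast (by omega : m₁ ≤ ℓ p)
    nlinarith
  · obtain ⟨p, hpy, hpM⟩ := h.exists_prefix y (n := M) (by omega)
    have hpg := hpy.trans h hpre
    have e1 := (h.mem_slow.1 hslow).2 p hpy hpM.ge
    have e2 := hK x (c * z) p (p⁻¹ * (x * (c * z))) (hal.trans (by omega)) (hpg.aligned _)
      (by group) (by omega) (by omega)
    have e3 := (hL' x p).trans (Nat.add_le_add_left (Nat.mul_le_mul_left L e2) _)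
    have e4 : (f x : ℝ) ≤ f p + L * K := by exact_mod_cast e3
    have e5 : (M₀ : ℝ) ≤ M := by exact_mod_cast hM
    rw [hpM] at e1
    nlinarith

/-- If a positive proportion of elements is fast on infinitely many spheres, then slow elements
have vanishing proportion. -/
theorem eventually_card_slow_le (hp : IsHypPair ℓ f) {s t a : ℝ} (hs : 0 ≤ s) (hst : s < t)
    (ha : 0 < a) (hfast : ∃ᶠ M in Filter.atTop,
      a * (hp.len.sphere M).card ≤ (hp.len.fast f t M).card) (m : ℕ) {η : ℝ} (hη : 0 < η) :
    ∀ᶠ N in Filter.atTop,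
      ((hp.len.slow f s m N).card : ℝ) ≤ η * (hp.len.sphere N).card := by
  classical
  by_contra hcon
  rw [Filter.not_eventually] at hcon
  obtain ⟨s', hs', ht⟩ := exists_between hst
  obtain ⟨D, C₁, M₀, hM₀⟩ := hp.exists_card_fast_mul_card_slow_le hs hs' ht
  obtain ⟨C, hC, hC', hCm⟩ := hp.exists_card_sphere_le
  have h := hp.len
  have := hp.infinite
  have pos : ∀ n, (0 : ℝ) < (h.sphere n).card := fun n => by
    exact_mod_cast (h.sphere_nonempty n).card_pos
  have hC0 : (0 : ℝ) < C := by exact_mod_cast hC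
  have lower : ∀ N, η / C * (h.sphere N).card ≤ (h.slow f s m N).card := by
    intro N
    obtain ⟨N', hN', hlt⟩ := Filter.frequently_atTop.1 hcon N
    obtain ⟨k, rfl⟩ := Nat.exists_eq_add_of_le hN'
    rw [not_le] at hlt
    have e1 : ((h.slow f s m (N + k)).card : ℝ) ≤ (h.slow f s m N).card * (h.sphere k).card := by
      exact_mod_cast h.card_slow_add_le f s m N k
    have e2 : ((h.sphere N).card : ℝ) * (h.sphere k).card ≤ C * (h.sphere (N + k)).card := by
      exact_mod_cast hCm N k
    rw [div_mul_eq_mul_div, div_le_iff₀ hC0]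
    refine le_of_mul_le_mul_right ?_ (pos k)
    nlinarith
  set κ := a * (η / C) / (C * (C₁ + 1)) with hκ
  have hκ0 : 0 < κ := by positivity
  have grow : ∀ J : ℕ, ∃ m' N₀, ∀ N, N₀ ≤ N →
      J * κ * (h.sphere N).card ≤ (h.slow f s' m' N).card := by
    intro J
    induction J with
    | zero => exact ⟨0, 0, fun N _ => by simp⟩
    | succ J ih =>
      obtain ⟨m', N₀, hN₀⟩ := ih
      obtain ⟨M, hM, hMa⟩ := Filter.frequently_atTop.1 hfast (max M₀ m')
      obtain ⟨m'', hm'', hm⟩ := hM₀ M (le_of_max_le_left hM) m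
      refine ⟨m'', max N₀ M, fun N hN => ?_⟩
      have e1 := hN₀ N (le_of_max_le_left hN)
      have e2 := hm N (le_of_max_le_right hN)
        (h.slow f s' m'' N \ h.slow f s' M N) (fun y hy hy' => Finset.mem_sdiff.2 ⟨hy, hy'⟩)
      have e3 := Finset.card_sdiff_add_card_eq_card (h.slow_subset_slow f s' hm'' N)
      have e4 := Finset.card_le_card (h.slow_subset_slow f s' (le_of_max_le_right hM) N)
      have e5 := lower (N - M + D)
      have e6 : (h.sphere N).card ≤ (h.sphere M).card * (C * (h.sphere (N - M + D)).card) := by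
        have b1 := h.card_sphere_add_le M (N - M)
        rw [Nat.add_sub_cancel' (le_of_max_le_right hN)] at b1
        exact b1.trans (Nat.mul_le_mul_left _ (hC' _ _))
      have e7 : ((h.sphere N).card : ℝ) ≤
          (h.sphere M).card * (C * (h.sphere (N - M + D)).card) := by exact_mod_cast e6
      have e8 : ((h.fast f t M).card : ℝ) * (h.slow f s m (N - M + D)).card ≤
          C₁ * (h.slow f s' m'' N \ h.slow f s' M N).card := by exact_mod_cast e2
      have e9 : a * (h.sphere M).card * (η / C * (h.sphere (N - M + D)).card) ≤
          (h.fast f t M).card * (h.slow f s m (N - M + D)).card := by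
        gcongr
      have e10 : κ * (h.sphere N).card ≤ (h.slow f s' m'' N \ h.slow f s' M N).card := by
        rw [hκ, div_mul_eq_mul_div, div_le_iff₀ (by positivity)]
        have b1 : a * (η / C) * (h.sphere N).card ≤
            C * (a * (h.sphere M).card * (η / C * (h.sphere (N - M + D)).card)) := by
          calc _ ≤ a * (η / C) * ((h.sphere M).card * (C * (h.sphere (N - M + D)).card)) := by
                gcongr
            _ = _ := by ring
        have b2 : (0 : ℝ) ≤ (h.slow f s' m'' N \ h.slow f s' M N).card := by positivity
        have b3 := mul_le_mul_of_nonneg_left (e9.trans e8) hC0.le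
        nlinarith
      have e11 : ((h.slow f s' m' N).card : ℝ) + (h.slow f s' m'' N \ h.slow f s' M N).card ≤
          (h.slow f s' m'' N).card := by exact_mod_cast (by omega)
      push_cast
      linarith
  obtain ⟨J, hJ⟩ := exists_nat_gt (1 / κ)
  obtain ⟨m', N₀, hN₀⟩ := grow J
  have e1 := hN₀ N₀ le_rfl
  have e2 : ((h.slow f s' m' N₀).card : ℝ) ≤ (h.sphere N₀).card := by
    exact_mod_cast h.card_slow_le f s' m' N₀
  rw [div_lt_iff₀ hκ0] at hJ
  have := mul_lt_mul_of_pos_right hJ (pos N₀)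
  linarith

end IsHypPair

end Slow

end HypFlow

namespace HypFlow

section Lower

variable {Γ : Type*} [Group Γ] {ℓ f : Γ → ℕ}

namespace IsHypPair

/-- A geodesic most of whose segments of length `K` are not slow has large `f`-length. -/
theorem exists_le_of_notMem_slow (hp : IsHypPair ℓ f) {s : ℝ} (hs : 0 ≤ s) :
    ∃ A : ℝ, 0 < A ∧ ∀ (m K N : ℕ) (y : ℕ → Γ) (B : Finset ℕ), 1 ≤ m →
      (∀ i j, i ≤ j → j ≤ N → ℓ ((y i)⁻¹ * y j) = j - i) →
      (∀ i, i + K ≤ N → i ∉ B → (y i)⁻¹ * y (i + K) ∉ hp.len.slow f s m K) →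
      s * N - s * K - A / m * N - (s + A) * B.card ≤ f ((y 0)⁻¹ * y N) := by
  obtain ⟨L, hL, hL'⟩ := hp.exists_abs_sub_le
  obtain ⟨K₀, hK₀⟩ := hp.track 0
  obtain ⟨K₁, hK₁⟩ := hp.add_le 0
  have h := hp.len
  refine ⟨L * K₀ + K₁ + L + 1, by positivity, fun m K N y B hm hy hB => ?_⟩
  set A : ℝ := L * K₀ + K₁ + L + 1 with hA
  have hA0 : 0 < A := by positivity
  have hm0 : (0 : ℝ) < m := by exact_mod_cast hm
  have hAm : 0 < A / m := by positivity
  have key : ∀ n ≤ N, s * n - s * K - A / m * n - (s + A) * (B.filter (N - n ≤ ·)).card ≤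
      f ((y (N - n))⁻¹ * y N) := by
    intro n
    induction n using Nat.strong_induction_on with
    | _ n ih =>
    intro hn
    set i := N - n with hi
    rcases (em (n < K ∨ n = 0)) with hnK | hnK
    · have e1 : s * (n : ℝ) ≤ s * K := by
        have : n ≤ K := by omega
        gcongr
      have e2 : (0 : ℝ) ≤ f ((y i)⁻¹ * y N) := by positivity
      have e3 : 0 ≤ A / m * n := by positivity
      have e4 : 0 ≤ (s + A) * (B.filter (i ≤ ·)).card := by positivity
      linarith
    push Not at hnK
    obtain ⟨hnK, hn0⟩ := hnK
    by_cases hiB : i ∈ B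
    · have e1 := ih (n - 1) (by omega) (by omega)
      rw [show N - (n - 1) = i + 1 by omega] at e1
      have e3 := hy i (i + 1) (by omega) (by omega)
      rw [h.dist_comm] at e3
      have e2 := hp.mul_le ((y (i + 1))⁻¹ * y i) ((y i)⁻¹ * y N)
      rw [show (y (i + 1))⁻¹ * y i * ((y i)⁻¹ * y N) = (y (i + 1))⁻¹ * y N by group] at e2
      have e4 := hL ((y (i + 1))⁻¹ * y i)
      rw [e3, show i + 1 - i = 1 by omega, mul_one] at e4
      have e5 : (f ((y (i + 1))⁻¹ * y N) : ℝ) ≤ L + f ((y i)⁻¹ * y N) := by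
        exact_mod_cast e2.trans (by omega)
      have e6 : (B.filter (i + 1 ≤ ·)).card + 1 ≤ (B.filter (i ≤ ·)).card := by
        refine Finset.card_lt_card (Finset.ssubset_iff_of_subset ?_ |>.2 ⟨i, ?_, ?_⟩)
        · exact Finset.monotone_filter_right B fun j _ (hj : i + 1 ≤ j) => by omega
        · simp [hiB]
        · simp
      have e7 : ((B.filter (i + 1 ≤ ·)).card : ℝ) + 1 ≤ (B.filter (i ≤ ·)).card := by
        exact_mod_cast e6
      have e8 : (s + A) * (((B.filter (i + 1 ≤ ·)).card : ℝ) + 1) ≤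
        (s + A) * (B.filter (i ≤ ·)).card := by gcongr
      have e9 : (L : ℝ) ≤ A := by
        rw [hA]
        have : (0 : ℝ) ≤ L * K₀ + K₁ := by positivity
        linarith
      rw [Nat.cast_sub (by omega), Nat.cast_one] at e1
      linarith
    · have hnot := hB i (by omega) hiB
      have hiK := hy i (i + K) (by omega) (by omega)
      rw [Nat.add_sub_cancel_left] at hiK
      obtain ⟨p, hpre, hpm, hpf⟩ : ∃ p, IsPrefix ℓ p ((y i)⁻¹ * y (i + K)) ∧ m ≤ ℓ p ∧
          s * ℓ p ≤ f p := by
        by_contra! hc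
        exact hnot (h.mem_slow.2 ⟨hiK, hc⟩)
      have hpK := hpre.le
      have e1 := ih (n - ℓ p) (by omega) (by omega)
      rw [show N - (n - ℓ p) = i + ℓ p by omega] at e1
      have d1 := hy i (i + ℓ p) (by omega) (by omega)
      have d2 := hy (i + ℓ p) (i + K) (by omega) (by omega)
      have d3 := hy (i + ℓ p) N (by omega) (by omega)
      have d4 := hy i N (by omega) (by omega)
      have e2 := hK₀ p (p⁻¹ * ((y i)⁻¹ * y (i + K))) ((y i)⁻¹ * y (i + ℓ p))
        ((y (i + ℓ p))⁻¹ * y (i + K)) (hpre.aligned _)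
        (by
          unfold Aligned
          rw [show (y i)⁻¹ * y (i + ℓ p) * ((y (i + ℓ p))⁻¹ * y (i + K)) =
            (y i)⁻¹ * y (i + K) by group]
          omega) (by group) (by omega) (by omega)
      have e3 := (hL' p ((y i)⁻¹ * y (i + ℓ p))).trans
        (Nat.add_le_add_left (Nat.mul_le_mul_left L e2) _)
      have e4 := hK₁ ((y i)⁻¹ * y (i + ℓ p)) ((y (i + ℓ p))⁻¹ * y N) (by
        unfold Aligned
        rw [show (y i)⁻¹ * y (i + ℓ p) * ((y (i + ℓ p))⁻¹ * y N) =
            (y i)⁻¹ * y N by group]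
        omega)
      rw [show (y i)⁻¹ * y (i + ℓ p) * ((y (i + ℓ p))⁻¹ * y N) =
            (y i)⁻¹ * y N by group] at e4
      have e5 : (f p : ℝ) + f ((y (i + ℓ p))⁻¹ * y N) ≤ f ((y i)⁻¹ * y N) + L * K₀ + K₁ := by
        exact_mod_cast (by omega)
      have e6 : ((B.filter (i + ℓ p ≤ ·)).card : ℝ) ≤ (B.filter (i ≤ ·)).card := by
        exact_mod_cast Finset.card_le_card
          (Finset.monotone_filter_right B fun j _ (hj : i + ℓ p ≤ j) => by omega)
      have e7 : A ≤ A / m * ℓ p := by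
        rw [div_mul_eq_mul_div, le_div_iff₀ hm0]
        have : (m : ℝ) ≤ ℓ p := by exact_mod_cast hpm
        gcongr
      rw [Nat.cast_sub (by omega)] at e1
      nlinarith
  have := key N le_rfl
  rw [Nat.sub_self] at this
  have e : ((B.filter (0 ≤ ·)).card : ℝ) ≤ B.card := by
    exact_mod_cast Finset.card_filter_le _ _
  nlinarith

end IsHypPair

theorem IsLen.card_filter_segment_le (h : IsLen ℓ) (Z : Γ → ℕ → Γ) (hZ0 : ∀ z, Z z 0 = 1)
    (hZ1 : ∀ z, Z z (ℓ z) = z) (hZ : ∀ z i j, i ≤ j → j ≤ ℓ z → ℓ ((Z z i)⁻¹ * Z z j) = j - i)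
    {i K N : ℕ} (hi : i + K ≤ N) (B : Finset Γ) [DecidableEq Γ] :
    ((h.sphere N).filter fun z => (Z z i)⁻¹ * Z z (i + K) ∈ B).card ≤
      (h.sphere i).card * B.card * (h.sphere (N - (i + K))).card := by
  rw [← Finset.card_product, ← Finset.card_product]
  refine Finset.card_le_card_of_injOn (fun z => ((Z z i, (Z z i)⁻¹ * Z z (i + K)),
    (Z z (i + K))⁻¹ * z)) (fun z hz => ?_) ?_
  · simp only [Finset.coe_filter, Set.mem_ofPred_eq, IsLen.mem_sphere] at hz
    obtain ⟨hz, hzB⟩ := hz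
    have e1 := hZ z 0 i (by omega) (by omega)
    have e2 := hZ z (i + K) N (by omega) (by omega)
    rw [← hz, hZ1] at e2
    simp only [hZ0, inv_one, one_mul] at e1
    simp only [Finset.coe_product, Set.mem_prod, Finset.mem_coe, mem_sphere]
    refine ⟨⟨by omega, hzB⟩, by omega⟩
  · intro x _ z _ hxz
    simp only [Prod.mk.injEq] at hxz
    obtain ⟨⟨h1, h2⟩, h3⟩ := hxz
    rw [h1, mul_right_inj] at h2
    rwa [h2, mul_right_inj] at h3

end Lower

end HypFlow

namespace HypFlow

section LowerBound

open Filter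

variable {Γ : Type*} [Group Γ] {ℓ f : Γ → ℕ}

namespace IsHypPair

/-- If slow elements are rare, then few elements have `f`-length below the slow rate. -/
theorem eventually_card_lt_le (hp : IsHypPair ℓ f) {s s' : ℝ} (hs : 0 ≤ s) (hs' : s' < s)
    (hslow : ∀ (m : ℕ) (η : ℝ), 0 < η → ∀ᶠ N : ℕ in atTop,
      ((hp.len.slow f s m N).card : ℝ) ≤ η * (hp.len.sphere N).card)
    {η : ℝ} (hη : 0 < η) :
    ∀ᶠ N : ℕ in atTop, (((hp.len.sphere N).filter fun z => (f z : ℝ) < s' * N).card : ℝ) ≤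
      η * (hp.len.sphere N).card := by
  classical
  have h := hp.len
  obtain ⟨A, hA, hlow⟩ := hp.exists_le_of_notMem_slow hs
  obtain ⟨C, hC, -, hmul⟩ := hp.exists_card_sphere_le
  have hC' : (0 : ℝ) < C := by exact_mod_cast hC
  choose Z hZ0 hZ1 hZ using h.exists_geodesic
  set ε := s - s' with hε
  have hε0 : 0 < ε := by linarith
  obtain ⟨m, hm⟩ := exists_nat_gt (4 * A / ε)
  have hm0 : (0 : ℝ) < m := lt_trans (by positivity) hm
  have hm1 : 1 ≤ m := by exact_mod_cast hm0
  have hAm : A / m ≤ ε / 4 := by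
    rw [div_lt_iff₀ hε0] at hm
    rw [div_le_iff₀ hm0]
    linarith
  set κ := ε / (4 * (s + A)) with hκ
  have hsA : 0 < s + A := by linarith
  have hκ0 : 0 < κ := by positivity
  have hsκ : (s + A) * κ = ε / 4 := by
    rw [hκ]; field_simp
  set η₀ := η * κ / C ^ 2 with hη₀
  obtain ⟨K, hK, hK1⟩ := ((hslow m η₀ (by positivity)).and (eventually_ge_atTop 1)).exists
  obtain ⟨N₀, hN₀⟩ := exists_nat_gt (4 * s * K / ε)
  filter_upwards [eventually_ge_atTop N₀, eventually_ge_atTop 1] with N hN hN1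
  have hN0 : (0 : ℝ) < N := by exact_mod_cast hN1
  have hsK : s * K ≤ ε / 4 * N := by
    have : (N₀ : ℝ) ≤ N := by exact_mod_cast hN
    rw [div_lt_iff₀ hε0] at hN₀
    nlinarith
  let bad (z : Γ) : Finset ℕ := (Finset.range N).filter fun i =>
    i + K ≤ N ∧ (Z z i)⁻¹ * Z z (i + K) ∈ h.slow f s m K
  have hcount : (∑ z ∈ h.sphere N, ((bad z).card : ℝ)) ≤ N * (η * κ * (h.sphere N).card) := by
    have e : ∑ z ∈ h.sphere N, (bad z).card = ∑ i ∈ Finset.range N,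
        ((h.sphere N).filter fun z =>
          i + K ≤ N ∧ (Z z i)⁻¹ * Z z (i + K) ∈ h.slow f s m K).card := by
      simp only [bad, Finset.card_filter]
      exact Finset.sum_comm
    have e' : (∑ z ∈ h.sphere N, ((bad z).card : ℝ)) = ∑ i ∈ Finset.range N,
        ((((h.sphere N).filter fun z =>
          i + K ≤ N ∧ (Z z i)⁻¹ * Z z (i + K) ∈ h.slow f s m K).card : ℕ) : ℝ) := by
      exact_mod_cast e
    rw [e']
    refine (Finset.sum_le_card_nsmul _ _ (η * κ * (h.sphere N).card) fun i _ => ?_).trans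
      (by simp)
    by_cases hi : i + K ≤ N
    · simp only [hi, true_and]
      have e1 := h.card_filter_segment_le Z hZ0 hZ1 hZ hi (h.slow f s m K)
      have e2 := hmul i K
      have e3 := hmul (i + K) (N - (i + K))
      rw [Nat.add_sub_cancel' hi] at e3
      calc _ ≤ ((h.sphere i).card : ℝ) * (h.slow f s m K).card *
              (h.sphere (N - (i + K))).card := by exact_mod_cast e1
        _ ≤ ((h.sphere i).card : ℝ) * (η₀ * (h.sphere K).card) *
              (h.sphere (N - (i + K))).card := by gcongr
        _ = η₀ * (((h.sphere i).card : ℝ) * (h.sphere K).card) *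
              (h.sphere (N - (i + K))).card := by ring
        _ ≤ η₀ * (C * (h.sphere (i + K)).card) * (h.sphere (N - (i + K))).card := by
            have : ((h.sphere i).card : ℝ) * (h.sphere K).card ≤ C * (h.sphere (i + K)).card := by
              exact_mod_cast e2
            gcongr
        _ = η₀ * C * (((h.sphere (i + K)).card : ℝ) * (h.sphere (N - (i + K))).card) := by ring
        _ ≤ η₀ * C * (C * (h.sphere N).card) := by
            have : ((h.sphere (i + K)).card : ℝ) * (h.sphere (N - (i + K))).card ≤
              C * (h.sphere N).card := by exact_mod_cast e3
            gcongr
        _ = η * κ * (h.sphere N).card := by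
            rw [hη₀]; field_simp
    · simp only [hi, false_and, Finset.filter_false, Finset.card_empty, Nat.cast_zero]
      positivity
  set E := (h.sphere N).filter fun z => (f z : ℝ) < s' * N with hE
  have hbad : ∀ z ∈ E, κ * N ≤ (bad z).card := by
    intro z hz
    simp only [hE, Finset.mem_filter, IsLen.mem_sphere] at hz
    obtain ⟨hz, hfz⟩ := hz
    by_contra! hc
    have e1 := hlow m K N (Z z) (bad z) hm1 (fun i j hij hj => hZ z i j hij (by omega))
      (fun i hi hib hmem => hib (Finset.mem_filter.2
        ⟨Finset.mem_range.2 (by omega), hi, hmem⟩))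
    rw [hZ0, inv_one, one_mul, ← hz, hZ1, hz] at e1
    have e2 : (s + A) * (bad z).card ≤ (s + A) * (κ * N) := by gcongr
    rw [← mul_assoc, hsκ] at e2
    have e3 : A / m * N ≤ ε / 4 * N := by gcongr
    have e4 : s * N - s' * N = ε * N := by rw [hε]; ring
    nlinarith
  have hE1 : (E.card : ℝ) * (κ * N) ≤ N * (η * κ * (h.sphere N).card) := by
    calc (E.card : ℝ) * (κ * N) = ∑ z ∈ E, κ * N := by simp
      _ ≤ ∑ z ∈ E, ((bad z).card : ℝ) := Finset.sum_le_sum hbad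
      _ ≤ ∑ z ∈ h.sphere N, ((bad z).card : ℝ) :=
        Finset.sum_le_sum_of_subset_of_nonneg (Finset.filter_subset _ _) fun _ _ _ => by positivity
      _ ≤ _ := hcount
  have hκN : 0 < κ * N := by positivity
  refine le_of_mul_le_mul_right (hE1.trans_eq ?_) hκN
  ring

end IsHypPair

end LowerBound

end HypFlow

namespace HypFlow

section LawOfLargeNumbers

open Filter Topology

variable {Γ : Type*} [Group Γ] {ℓ f : Γ → ℕ}

namespace IsHypPair

open Classical in
/-- Weak law of large numbers on spheres. -/
theorem exists_weak_law (hp : IsHypPair ℓ f) : ∃ τ : ℝ, 0 ≤ τ ∧ ∀ ε η : ℝ, 0 < ε → 0 < η →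
    ∀ᶠ N : ℕ in atTop, (((hp.len.sphere N).filter fun z =>
      ε * N < |(f z : ℝ) - N * τ|).card : ℝ) ≤ η * (hp.len.sphere N).card := by
  have h := hp.len
  have := hp.infinite
  obtain ⟨L, hL, -⟩ := hp.exists_abs_sub_le
  let T : Set ℝ := {t | 0 ≤ t ∧ ∃ a : ℝ, 0 < a ∧
    ∃ᶠ M : ℕ in atTop, a * (h.sphere M).card ≤ (h.fast f t M).card}
  have hT0 : (0 : ℝ) ∈ T := by
    refine ⟨le_rfl, 1, one_pos, Eventually.frequently (Eventually.of_forall fun M => ?_)⟩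
    rw [one_mul, Nat.cast_le]
    refine Finset.card_le_card fun x hx => h.mem_fast.2 ⟨h.mem_sphere.1 hx, ?_⟩
    rw [zero_mul]
    positivity
  have hTL : ∀ t ∈ T, t ≤ L := by
    rintro t ⟨-, a, ha, hfr⟩
    obtain ⟨M, hM, hM1⟩ := (hfr.and_eventually (eventually_ge_atTop 1)).exists
    have hpos : (0 : ℝ) < (h.sphere M).card := by
      exact_mod_cast Finset.card_pos.2 (h.sphere_nonempty M)
    have hpos' : (0 : ℝ) < (h.fast f t M).card := lt_of_lt_of_le (by positivity) hM
    obtain ⟨x, hx⟩ := Finset.card_pos.1 (by exact_mod_cast hpos' : 0 < (h.fast f t M).card)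
    obtain ⟨hx, hfx⟩ := h.mem_fast.1 hx
    have e1 : (f x : ℝ) ≤ L * M := by
      rw [← hx]
      exact_mod_cast hL x
    have hM0 : (0 : ℝ) < M := by exact_mod_cast hM1
    exact le_of_mul_le_mul_right (hfx.trans e1) hM0
  have hbdd : BddAbove T := ⟨L, hTL⟩
  refine ⟨sSup T, le_csSup hbdd hT0, fun ε η hε hη => ?_⟩
  set τ := sSup T
  have hτ0 : 0 ≤ τ := le_csSup hbdd hT0
  have hup : ∀ᶠ N : ℕ in atTop,
      ((h.fast f (τ + ε) N).card : ℝ) ≤ η / 2 * (h.sphere N).card := by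
    have hnot : τ + ε ∉ T := fun hmem => by linarith [le_csSup hbdd hmem]
    have : ¬ ∃ᶠ M : ℕ in atTop, η / 2 * (h.sphere M).card ≤ (h.fast f (τ + ε) M).card :=
      fun hc => hnot ⟨by positivity, η / 2, by positivity, hc⟩
    rw [not_frequently] at this
    exact this.mono fun N hN => (not_le.1 hN).le
  have hdown : ∀ᶠ N : ℕ in atTop,
      (((h.sphere N).filter fun z => (f z : ℝ) < (τ - ε) * N).card : ℝ) ≤
        η / 2 * (h.sphere N).card := by
    rcases lt_or_ge (τ - ε) 0 with hneg | hnn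
    · refine Eventually.of_forall fun N => ?_
      rw [Finset.filter_false_of_mem fun z _ => not_lt.2 ?_]
      · rw [Finset.card_empty, Nat.cast_zero]
        positivity
      · exact (mul_nonpos_of_nonpos_of_nonneg hneg.le (by positivity)).trans (by positivity)
    · obtain ⟨t, ⟨-, a, ha, hfr⟩, ht⟩ := exists_lt_of_lt_csSup ⟨0, hT0⟩ (show τ - ε < τ by linarith)
      have hs : 0 ≤ (τ - ε + t) / 2 := by linarith
      exact hp.eventually_card_lt_le hs (by linarith)
        (fun m η' hη' => hp.eventually_card_slow_le hs (by linarith) ha hfr m hη') (by positivity)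
  filter_upwards [hup, hdown] with N h1 h2
  have hsub : ((h.sphere N).filter fun z => ε * N < |(f z : ℝ) - N * τ|) ⊆
      h.fast f (τ + ε) N ∪ (h.sphere N).filter fun z => (f z : ℝ) < (τ - ε) * N := by
    intro z hz
    rw [Finset.mem_filter, h.mem_sphere] at hz
    obtain ⟨hz, hd⟩ := hz
    rw [Finset.mem_union, h.mem_fast, Finset.mem_filter, h.mem_sphere]
    rcases lt_abs.1 hd with hd | hd
    · exact Or.inl ⟨hz, by linarith⟩
    · exact Or.inr ⟨hz, by linarith⟩
  have e : (((h.sphere N).filter fun z => ε * N < |(f z : ℝ) - N * τ|).card : ℝ) ≤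
      (h.fast f (τ + ε) N).card +
        ((h.sphere N).filter fun z => (f z : ℝ) < (τ - ε) * N).card := by
    exact_mod_cast (Finset.card_le_card hsub).trans (Finset.card_union_le _ _)
  linarith

open Classical in
/-- Means over spheres converge to the constant of the weak law. -/
theorem tendsto_mean (hp : IsHypPair ℓ f) {τ : ℝ} (hτ : 0 ≤ τ)
    (hlaw : ∀ ε η : ℝ, 0 < ε → 0 < η → ∀ᶠ N : ℕ in atTop, (((hp.len.sphere N).filter fun z =>
      ε * N < |(f z : ℝ) - N * τ|).card : ℝ) ≤ η * (hp.len.sphere N).card) :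
    Tendsto (fun N : ℕ => (∑ z ∈ hp.len.sphere N, (f z : ℝ)) / (hp.len.sphere N).card / N)
      atTop (𝓝 τ) := by
  have h := hp.len
  have := hp.infinite
  obtain ⟨L, hL, -⟩ := hp.exists_abs_sub_le
  rw [Metric.tendsto_nhds]
  intro ε hε
  set η := ε / (4 * (L + τ + 1)) with hη
  have hη0 : 0 < η := by positivity
  have hηL : (L + τ) * η ≤ ε / 4 := by
    rw [hη, mul_div_assoc', div_le_div_iff₀ (by positivity) (by positivity)]
    nlinarith
  filter_upwards [hlaw (ε / 2) η (by positivity) hη0, eventually_ge_atTop 1] with N hN hN1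
  have hN0 : (0 : ℝ) < N := by exact_mod_cast hN1
  set c : ℝ := ((h.sphere N).card : ℝ) with hc
  have hc0 : 0 < c := by
    rw [hc]
    exact_mod_cast Finset.card_pos.2 (h.sphere_nonempty N)
  have hpt : ∀ z ∈ h.sphere N, |(f z : ℝ) - N * τ| ≤
      ε / 2 * N + if ε / 2 * N < |(f z : ℝ) - N * τ| then (L + τ) * N else 0 := by
    intro z hz
    split_ifs with hd
    · have e1 : (f z : ℝ) ≤ L * N := by
        rw [← h.mem_sphere.1 hz]
        exact_mod_cast hL z
      have e2 : (0 : ℝ) ≤ f z := by positivity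
      have e3 : (0 : ℝ) ≤ L * N := by positivity
      have e4 : 0 ≤ N * τ := by positivity
      have e5 : 0 ≤ ε / 2 * N := by positivity
      rw [abs_le]
      constructor <;> linarith
    · linarith
  have hsum : |(∑ z ∈ h.sphere N, (f z : ℝ)) - c * (N * τ)| ≤ c * (3 / 4 * ε * N) := by
    calc |(∑ z ∈ h.sphere N, (f z : ℝ)) - c * (N * τ)|
        = |∑ z ∈ h.sphere N, ((f z : ℝ) - N * τ)| := by simp [hc]
      _ ≤ ∑ z ∈ h.sphere N, |(f z : ℝ) - N * τ| := Finset.abs_sum_le_sum_abs _ _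
      _ ≤ ∑ z ∈ h.sphere N, (ε / 2 * N +
          if ε / 2 * N < |(f z : ℝ) - N * τ| then (L + τ) * N else 0) := Finset.sum_le_sum hpt
      _ = c * (ε / 2 * N) + ((h.sphere N).filter fun z =>
          ε / 2 * N < |(f z : ℝ) - N * τ|).card * ((L + τ) * N) := by
        rw [Finset.sum_add_distrib, ← Finset.sum_filter]
        simp [hc]
      _ ≤ c * (ε / 2 * N) + η * c * ((L + τ) * N) := by gcongr
      _ = c * (ε / 2 * N) + c * N * ((L + τ) * η) := by ring
      _ ≤ c * (ε / 2 * N) + c * N * (ε / 4) := by gcongr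
      _ = _ := by ring
  have hcN : 0 < c * N := by positivity
  rw [Real.dist_eq, show (∑ z ∈ h.sphere N, (f z : ℝ)) / c / N - τ =
    ((∑ z ∈ h.sphere N, (f z : ℝ)) - c * (N * τ)) / (c * N) by field_simp, abs_div,
    abs_of_pos hcN, div_lt_iff₀ hcN]
  refine hsum.trans_lt ?_
  nlinarith

end IsHypPair

end LawOfLargeNumbers

end HypFlow

namespace HypFlow

section Statements

open MeasureTheory Filter Topology
open scoped ENNReal

theorem stmt2 {Γ : Type*} [Group Γ]
    (hΓ : NonElemHyperbolic Γ)
    (S Sst : Set Γ) (hS : IsSymmGen S) (hSst : IsSymmGen Sst) :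
    Tendsto (fun n : ℕ => meanLen S Sst n / (n : ℝ)) atTop (𝓝 (meanDistortion S Sst)) ∧
    ∀ ε : ℝ, 0 < ε →
      Tendsto (fun n : ℕ =>
          (Nat.card {x : Γ // wordLength S x = n ∧
              ε * (n : ℝ) < |(wordLength Sst x : ℝ) - (n : ℝ) * meanDistortion S Sst|} : ℝ)
            / (sphCard S n : ℝ))
        atTop (𝓝 0) := by
  obtain ⟨⟨S₀, hS₀, hhyp⟩, hvc⟩ := hΓ
  obtain ⟨δ, hδ⟩ := hhyp.exists_isHyp
  have hp := IsHypPair.of_isHyp hδ hS₀.isLen hvc hS.isLen hSst.isLen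
  have := hp.infinite
  obtain ⟨τ, hτ, hlaw⟩ := hp.exists_weak_law
  have hcard (n : ℕ) : sphCard S n = (hp.len.sphere n).card := by
    rw [sphCard]
    exact Nat.subtype_card _ fun x => hp.len.mem_sphere
  have hmean (n : ℕ) : meanLen S Sst n =
      (∑ z ∈ hp.len.sphere n, (wordLength Sst z : ℝ)) / (hp.len.sphere n).card := by
    rw [meanLen, hcard, ← Finset.tsum_subtype]
    congr 1
    exact (Equiv.subtypeEquivRight fun x => (hp.len.mem_sphere (n := n) (x := x)).symm).tsum_eq
      fun x : {x // x ∈ hp.len.sphere n} => (wordLength Sst (x : Γ) : ℝ)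
  have htend : Tendsto (fun n : ℕ => meanLen S Sst n / (n : ℝ)) atTop (𝓝 τ) := by
    simp only [hmean]
    exact hp.tendsto_mean hτ hlaw
  have hdist : meanDistortion S Sst = τ := htend.liminf_eq
  rw [hdist]
  refine ⟨htend, fun ε hε => ?_⟩
  rw [Metric.tendsto_nhds]
  intro η hη
  filter_upwards [hlaw ε (η / 2) hε (by positivity)] with n hn
  have hc : (0 : ℝ) < (hp.len.sphere n).card := by
    exact_mod_cast Finset.card_pos.2 (hp.len.sphere_nonempty n)
  classical
  rw [hcard, Nat.subtype_card ((hp.len.sphere n).filter fun z =>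
      ε * n < |(wordLength Sst z : ℝ) - n * τ|) fun x => by
        rw [Finset.mem_filter, hp.len.mem_sphere], Real.dist_0_eq_abs,
    abs_of_nonneg (by positivity), div_lt_iff₀ hc]
  convert lt_of_le_of_lt hn _
  nlinarith

end Statements

end HypFlow
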